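/- arXiv:2205.07593 — 4 statements merged into one kernel-verified Lean document; each statement's English description precedes it below -/
import Mathlib

section
/- For every constant c ≥ 10, every ε ∈ (0, 1/4) and every input signed graph on n ≥ 2 vertices, the clustering output by sequential Truncated-Pivot run with a uniformly random permutation π has expected cost at most (3 + 12ε)·OPT + (1 + 4ε)·n^{3 − c/2}. In particular, whenever OPT ≥ 1 and n is large enough, the expected cost is at most (3 + 13ε)·OPT. -/
open scoped Classical

namespace TruncatedPivot

/-- Status of a node during the run of (sequential) Truncated-Pivot. -/
inductive Status (N : ℕ) where
  | active : Status N
  | singleton : Status N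
  | clustered : Fin N → Status N
  deriving DecidableEq

variable {N : ℕ}

/-- Degree of `u`: number of positive edges incident on `u`. -/
def deg (adj : Fin N → Fin N → Bool) (u : Fin N) : ℕ :=
  (Finset.univ.filter fun v => adj u v = true).card

/-- Number of disagreements of the clustering whose parts are the fibers of `f`:
positive pairs split between two parts plus negative pairs inside one part. -/
def cost (adj : Fin N → Fin N → Bool) (f : Fin N → Fin N) : ℕ :=
  (Finset.univ.filter fun p : Fin N × Fin N =>
    p.1 < p.2 ∧ ((adj p.1 p.2 = true ∧ f p.1 ≠ f p.2) ∨
      (adj p.1 p.2 = false ∧ f p.1 = f p.2))).card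

/-- Minimum number of disagreements over all clusterings (every partition of `Fin N`
arises as the fibers of some `f : Fin N → Fin N`). -/
noncomputable def OPT (adj : Fin N → Fin N → Bool) : ℕ :=
  sInf (Set.range (cost adj))

/-- The singleton-creating sub-step of iteration `i` of sequential Truncated-Pivot:
every active node `v` with `deg v ≥ (c/ε)·(N·log N)/i` (equivalently
`deg v · i ≥ (c/ε)·(N·log N)`, as `i ≥ 1`) becomes a singleton cluster. -/
noncomputable def singStep (adj : Fin N → Fin N → Bool) (c ε : ℝ) (i : ℕ)
    (s : Fin N → Status N) : Fin N → Status N := fun v =>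
  if s v = Status.active ∧ (c / ε) * ((N : ℝ) * Real.log N) ≤ (deg adj v : ℝ) * (i : ℝ) then
    Status.singleton
  else s v

/-- The pivot sub-step: if `u` is still active, it forms a pivot cluster together with all
of its currently active positive neighbors. -/
def pivStep (adj : Fin N → Fin N → Bool) (u : Fin N) (s : Fin N → Status N) :
    Fin N → Status N := fun v =>
  if s u = Status.active ∧ s v = Status.active ∧ (v = u ∨ adj u v = true) then
    Status.clustered u
  else s v

/-- `seqStates adj c ε π k` is the status of every node after the first `k` iterations of
sequential Truncated-Pivot run with permutation `π` (iteration `i = k+1` processes the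
node at position `i`, i.e. `π.symm ⟨k⟩`). -/
noncomputable def seqStates (adj : Fin N → Fin N → Bool) (c ε : ℝ) (π : Equiv.Perm (Fin N)) :
    ℕ → Fin N → Status N
  | 0 => fun _ => Status.active
  | k + 1 =>
    if h : k < N then
      pivStep adj (π.symm ⟨k, h⟩) (singStep adj c ε (k + 1) (seqStates adj c ε π k))
    else seqStates adj c ε π k

/-- The cluster label (representative) of each node in the clustering output by
sequential Truncated-Pivot: members of the pivot cluster of pivot `p` get label `p`,
singleton clusters get the node itself. -/
noncomputable def seqLabel (adj : Fin N → Fin N → Bool) (c ε : ℝ) (π : Equiv.Perm (Fin N))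
    (v : Fin N) : Fin N :=
  match seqStates adj c ε π N v with
  | Status.clustered p => p
  | _ => v

/-- The state in iteration `k+1` just after the singleton sub-step and right before the
pivot sub-step. -/
noncomputable def midState (adj : Fin N → Fin N → Bool) (c ε : ℝ) (π : Equiv.Perm (Fin N))
    (k : ℕ) : Fin N → Status N :=
  singStep adj c ε (k + 1) (seqStates adj c ε π k)

/-- Membership in the (potential) pivot cluster of pivot `p`. -/
def inPivCluster (adj : Fin N → Fin N → Bool) (p v : Fin N) : Prop :=
  v = p ∨ adj p v = true

/-- The (positive) edge `{a,b}` is cut by the pivot cluster created at iteration `k+1`: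
the pivot and both endpoints are active when the cluster is created, and exactly one of
`a`, `b` is included in the cluster. -/
def cutAt (adj : Fin N → Fin N → Bool) (c ε : ℝ) (π : Equiv.Perm (Fin N)) (k : Fin N)
    (a b : Fin N) : Prop :=
  midState adj c ε π k.val (π.symm k) = Status.active ∧
  midState adj c ε π k.val a = Status.active ∧
  midState adj c ε π k.val b = Status.active ∧
  ((inPivCluster adj (π.symm k) a ∧ ¬ inPivCluster adj (π.symm k) b) ∨
    (inPivCluster adj (π.symm k) b ∧ ¬ inPivCluster adj (π.symm k) a))

/-- `C^pivot`: the number of disagreements induced by the pivot clusters of sequential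
Truncated-Pivot: negative pairs inside a common pivot cluster, plus positive edges cut
by a pivot cluster at the iteration it was created. -/
noncomputable def Cpivot (adj : Fin N → Fin N → Bool) (c ε : ℝ) (π : Equiv.Perm (Fin N)) : ℕ :=
  (Finset.univ.filter fun p : Fin N × Fin N =>
    p.1 < p.2 ∧
      ((adj p.1 p.2 = true ∧ ∃ k : Fin N, cutAt adj c ε π k p.1 p.2) ∨
        (adj p.1 p.2 = false ∧ ∃ q : Fin N,
          seqStates adj c ε π N p.1 = Status.clustered q ∧
          seqStates adj c ε π N p.2 = Status.clustered q))).card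

/-- A bad triangle: three distinct vertices with exactly two positive edges. -/
def IsBadTriangle (adj : Fin N → Fin N → Bool) (t : Finset (Fin N)) : Prop :=
  ∃ u v w : Fin N, t = {u, v, w} ∧ u ≠ v ∧ v ≠ w ∧ u ≠ w ∧
    adj u v = true ∧ adj v w = true ∧ adj u w = false

/-- The set `T` of all bad triangles. -/
noncomputable def badTriangles (adj : Fin N → Fin N → Bool) : Finset (Finset (Fin N)) :=
  Finset.univ.filter (IsBadTriangle adj)

/-- The event `A_t`: at some iteration of sequential Truncated-Pivot all three nodes of the
bad triangle `t` are active and one of them is the node of that iteration (hence it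
creates a pivot cluster). -/
def eventA (adj : Fin N → Fin N → Bool) (c ε : ℝ) (t : Finset (Fin N))
    (π : Equiv.Perm (Fin N)) : Prop :=
  ∃ k : Fin N, π.symm k ∈ t ∧ ∀ x ∈ t, midState adj c ε π k.val x = Status.active

/-- `N_i(u)`: positive neighbors `v` of `u` with `deg v ≤ deg u` that have not joined a
pivot cluster before iteration `i` (i.e. in the state at the beginning of iteration `i`). -/
noncomputable def NdegI (adj : Fin N → Fin N → Bool) (c ε : ℝ) (π : Equiv.Perm (Fin N))
    (i : ℕ) (u : Fin N) : Finset (Fin N) :=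
  Finset.univ.filter fun v => adj u v = true ∧ deg adj v ≤ deg adj u ∧
    ∀ p : Fin N, seqStates adj c ε π (i - 1) v ≠ Status.clustered p

/-- `u` is placed into a singleton cluster at iteration `i` (`1 ≤ i ≤ N`). -/
def becomesSingletonAt (adj : Fin N → Fin N → Bool) (c ε : ℝ) (π : Equiv.Perm (Fin N))
    (u : Fin N) (i : ℕ) : Prop :=
  1 ≤ i ∧ i ≤ N ∧ seqStates adj c ε π (i - 1) u = Status.active ∧
    seqStates adj c ε π i u = Status.singleton

/-- `E^sin`: positive edges with at least one endpoint in a singleton cluster. -/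
noncomputable def Esin (adj : Fin N → Fin N → Bool) (c ε : ℝ) (π : Equiv.Perm (Fin N)) :
    Finset (Fin N × Fin N) :=
  Finset.univ.filter fun p => p.1 < p.2 ∧ adj p.1 p.2 = true ∧
    (seqStates adj c ε π N p.1 = Status.singleton ∨
      seqStates adj c ε π N p.2 = Status.singleton)

/-- A good edge of `E^sin`: one endpoint is placed into a singleton cluster at some
iteration `i` and the other endpoint had joined a pivot cluster at some iteration `j < i`. -/
def goodPair (adj : Fin N → Fin N → Bool) (c ε : ℝ) (π : Equiv.Perm (Fin N))
    (a b : Fin N) : Prop :=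
  (∃ i : ℕ, becomesSingletonAt adj c ε π a i ∧
    ∃ p : Fin N, seqStates adj c ε π (i - 1) b = Status.clustered p) ∨
  (∃ i : ℕ, becomesSingletonAt adj c ε π b i ∧
    ∃ p : Fin N, seqStates adj c ε π (i - 1) a = Status.clustered p)

/-- `E^bad`: the edges of `E^sin` that are not good. -/
noncomputable def Ebad (adj : Fin N → Fin N → Bool) (c ε : ℝ) (π : Equiv.Perm (Fin N)) :
    Finset (Fin N × Fin N) :=
  (Esin adj c ε π).filter fun p => ¬ goodPair adj c ε π p.1 p.2

/-- A node `u` is interesting for permutation `π` iff `π_u < τ_u`, i.e.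
`π_u · deg u < (c/ε)·(N·log N)` where `π_u ∈ {1,…,N}` is the position of `u`. -/
def interesting (adj : Fin N → Fin N → Bool) (c ε : ℝ) (π : Equiv.Perm (Fin N))
    (u : Fin N) : Prop :=
  (((π u).val : ℝ) + 1) * (deg adj u : ℝ) < (c / ε) * ((N : ℝ) * Real.log N)

/-- The greedy maximal independent set of `G_store` (the subgraph induced by the
interesting nodes) along `π`: nodes are processed in increasing order of position and a
node joins iff it is interesting and has no earlier neighbor already in the set. -/
noncomputable def pivots (adj : Fin N → Fin N → Bool) (c ε : ℝ) (π : Equiv.Perm (Fin N)) :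
    Finset (Fin N) :=
  (List.finRange N).foldl
    (fun I j =>
      if interesting adj c ε π (π.symm j) ∧ ∀ v ∈ I, adj (π.symm j) v = false then
        insert (π.symm j) I
      else I) ∅

/-- The cluster label of each node in the clustering output by parallel Truncated-Pivot:
pivots are their own label; a non-pivot `u` joins its pivot positive neighbor `v` of
smallest position provided `π_v < τ_u`; all remaining nodes form singleton clusters. -/
noncomputable def parLabel (adj : Fin N → Fin N → Bool) (c ε : ℝ) (π : Equiv.Perm (Fin N))
    (u : Fin N) : Fin N :=
  if u ∈ pivots adj c ε π then u
  else
    let S := (pivots adj c ε π).filter fun v => adj u v = true ∧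
      (((π v).val : ℝ) + 1) * (deg adj u : ℝ) < (c / ε) * ((N : ℝ) * Real.log N)
    if h : S.Nonempty then π.symm ((S.image fun v => π v).min' (h.image _)) else u

/-- The number of positive edges with at least one interesting endpoint (i.e. with at
least one endpoint in `G_store`). -/
noncomputable def interEdges (adj : Fin N → Fin N → Bool) (c ε : ℝ)
    (π : Equiv.Perm (Fin N)) : Finset (Fin N × Fin N) :=
  Finset.univ.filter fun p => p.1 < p.2 ∧ adj p.1 p.2 = true ∧
    (interesting adj c ε π p.1 ∨ interesting adj c ε π p.2)

/-- Probability of an event over a uniformly random permutation of `Fin N`. -/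
noncomputable def Pr (N : ℕ) (P : Equiv.Perm (Fin N) → Prop) : ℝ :=
  ((Finset.univ.filter P).card : ℝ) / (Nat.factorial N : ℝ)

/-- Expectation of a real random variable over a uniformly random permutation of `Fin N`. -/
noncomputable def Ex (N : ℕ) (X : Equiv.Perm (Fin N) → ℝ) : ℝ :=
  (∑ π : Equiv.Perm (Fin N), X π) / (Nat.factorial N : ℝ)



section Run

variable (adj : Fin N → Fin N → Bool) (c ε : ℝ) (π : Equiv.Perm (Fin N))

theorem seqStates_succ (k : Fin N) (v : Fin N) :
    seqStates adj c ε π (k.val + 1) v =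
      if midState adj c ε π k (π.symm k) = Status.active ∧ midState adj c ε π k v = Status.active ∧
        (v = π.symm k ∨ adj (π.symm k) v = true) then Status.clustered (π.symm k)
      else midState adj c ε π k v := by
  simp only [seqStates, k.isLt, dif_pos, pivStep, midState, Fin.eta]
  congr

variable {adj c ε π}

theorem midState_eq_of_ne_active {k : ℕ} {v : Fin N}
    (h : seqStates adj c ε π k v ≠ Status.active) :
    midState adj c ε π k v = seqStates adj c ε π k v := by
  simp [midState, singStep, h]

theorem active_of_midState_active {k : ℕ} {v : Fin N}
    (h : midState adj c ε π k v = Status.active) : seqStates adj c ε π k v = Status.active := by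
  by_contra h'
  exact h' (midState_eq_of_ne_active h' ▸ h)

theorem midState_active_iff {k : ℕ} {v : Fin N} :
    midState adj c ε π k v = Status.active ↔ seqStates adj c ε π k v = Status.active ∧
      (deg adj v : ℝ) * (k + 1 : ℕ) < c / ε * ((N : ℝ) * Real.log N) := by
  constructor
  · intro h
    have h1 := active_of_midState_active h
    refine ⟨h1, ?_⟩
    by_contra h2
    simp only [midState, singStep, h1, true_and, if_pos (not_lt.1 h2)] at h
    cases h
  · rintro ⟨h1, h2⟩
    simp only [midState, singStep, h1, true_and, if_neg (not_le.2 h2)]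

theorem midState_active_of_succ {k : Fin N} {v : Fin N}
    (h : seqStates adj c ε π (k.val + 1) v = Status.active) :
    midState adj c ε π k v = Status.active := by
  rw [seqStates_succ] at h
  split_ifs at h
  exact h

theorem seqStates_succ_of_ne_active {k : ℕ} {v : Fin N}
    (h : seqStates adj c ε π k v ≠ Status.active) :
    seqStates adj c ε π (k + 1) v = seqStates adj c ε π k v := by
  by_cases hk : k < N
  · have h' := midState_eq_of_ne_active h
    rw [seqStates_succ adj c ε π ⟨k, hk⟩ v, if_neg (by simp [h', h]), h']
  · simp only [seqStates, dif_neg hk]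

theorem seqStates_eq_of_le {k l : ℕ} {v : Fin N} (hkl : k ≤ l)
    (h : seqStates adj c ε π k v ≠ Status.active) :
    seqStates adj c ε π l v = seqStates adj c ε π k v := by
  induction l, hkl using Nat.le_induction with
  | base => rfl
  | succ l _ ih => rw [seqStates_succ_of_ne_active (ih ▸ h), ih]

theorem active_of_le {k l : ℕ} {v : Fin N} (hkl : k ≤ l)
    (h : seqStates adj c ε π l v = Status.active) : seqStates adj c ε π k v = Status.active := by
  by_contra h'
  exact h' (seqStates_eq_of_le hkl h' ▸ h)

theorem midState_active_of_lt {k : ℕ} {l : ℕ} {v : Fin N} (hkl : k < l) (hl : k < N)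
    (h : seqStates adj c ε π l v = Status.active) : midState adj c ε π k v = Status.active :=
  midState_active_of_succ (k := ⟨k, hl⟩) (active_of_le hkl h)

theorem seqStates_succ_eq_clustered {k : Fin N} {v : Fin N}
    (hp : midState adj c ε π k (π.symm k) = Status.active)
    (hv : midState adj c ε π k v = Status.active)
    (h : v = π.symm k ∨ adj (π.symm k) v = true) :
    seqStates adj c ε π (k.val + 1) v = Status.clustered (π.symm k) := by
  rw [seqStates_succ, if_pos ⟨hp, hv, h⟩]

theorem le_position_of_active {l : ℕ} {v : Fin N}
    (h : seqStates adj c ε π l v = Status.active) : l ≤ (π v).val := by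
  by_contra! hl
  have h1 := active_of_le (Nat.succ_le_of_lt hl) h
  have h2 := midState_active_of_succ h1
  rw [seqStates_succ_eq_clustered (by simpa using h2) h2 (by simp)] at h1
  cases h1

theorem final_ne_active (v : Fin N) : seqStates adj c ε π N v ≠ Status.active := fun h =>
  absurd (le_position_of_active h) (π v).isLt.not_ge

theorem exists_deactivation {l : ℕ} {v : Fin N} (h : seqStates adj c ε π l v ≠ Status.active) :
    ∃ j < l, seqStates adj c ε π j v = Status.active ∧
      seqStates adj c ε π (j + 1) v ≠ Status.active := by
  induction l with
  | zero => exact absurd rfl h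
  | succ l ih =>
    by_cases h' : seqStates adj c ε π l v = Status.active
    · exact ⟨l, l.lt_succ_self, h', h⟩
    · obtain ⟨j, hj, h1⟩ := ih h'
      exact ⟨j, hj.trans l.lt_succ_self, h1⟩

theorem of_clustered {l : ℕ} (hl : l ≤ N) {v p : Fin N}
    (h : seqStates adj c ε π l v = Status.clustered p) :
    midState adj c ε π (π p) p = Status.active ∧ midState adj c ε π (π p) v = Status.active ∧
      (v = p ∨ adj p v = true) := by
  induction l with
  | zero => simp [seqStates] at h
  | succ l ih =>
    have h' := h
    rw [seqStates_succ adj c ε π ⟨l, hl⟩ v] at h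
    split_ifs at h with hc
    · obtain rfl := Status.clustered.inj h
      simpa using hc
    · refine ih (by omega) ?_
      by_cases ha : seqStates adj c ε π l v = Status.active
      · simp only [midState, singStep, ha, true_and] at h
        split_ifs at h
      · rw [← seqStates_succ_of_ne_active ha, h']

theorem clustered_succ_of_clustered {l : ℕ} (hl : l ≤ N) {v p : Fin N}
    (h : seqStates adj c ε π l v = Status.clustered p) :
    seqStates adj c ε π ((π p).val + 1) v = Status.clustered p := by
  obtain ⟨h1, h2, h3⟩ := of_clustered hl h
  have := seqStates_succ_eq_clustered (k := π p) (v := v) (by simpa using h1) h2 (by simpa using h3)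
  simpa using this

theorem clustered_self {l : ℕ} (hl : l ≤ N) {v p : Fin N}
    (h : seqStates adj c ε π l v = Status.clustered p) :
    seqStates adj c ε π N p = Status.clustered p := by
  obtain ⟨h1, -, -⟩ := of_clustered hl h
  have := seqStates_succ_eq_clustered (k := π p) (v := p) (by simpa using h1) h1 (by simp)
  rw [seqStates_eq_of_le (π p).isLt (by simp [this]), this]
  simp

theorem cutAt_comm {k a b : Fin N} : cutAt adj c ε π k a b ↔ cutAt adj c ε π k b a := by
  unfold cutAt
  tauto

theorem seqStates_succ_cases {k : Fin N} {v : Fin N}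
    (h : seqStates adj c ε π k v = Status.active)
    (h' : seqStates adj c ε π (k.val + 1) v ≠ Status.active) :
    (seqStates adj c ε π (k.val + 1) v = Status.singleton ∧
      c / ε * ((N : ℝ) * Real.log N) ≤ (deg adj v : ℝ) * (k.val + 1 : ℕ)) ∨
    (midState adj c ε π k (π.symm k) = Status.active ∧ midState adj c ε π k v = Status.active ∧
      inPivCluster adj (π.symm k) v ∧
      seqStates adj c ε π (k.val + 1) v = Status.clustered (π.symm k)) := by
  rw [seqStates_succ] at h' ⊢
  split_ifs at h' ⊢ with hc
  · exact Or.inr ⟨hc.1, hc.2.1, hc.2.2, rfl⟩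
  · left
    have : c / ε * ((N : ℝ) * Real.log N) ≤ (deg adj v : ℝ) * (k.val + 1 : ℕ) := by
      by_contra hlt
      exact h' (midState_active_iff.2 ⟨h, not_le.1 hlt⟩)
    exact ⟨by simp only [midState, singStep, h, true_and, if_pos this], this⟩

/-- A node clustered while another one survives the iteration: that pair is cut. -/
theorem cutAt_of_clustered_of_active {k a b : Fin N}
    (hp : midState adj c ε π k (π.symm k) = Status.active)
    (hb : midState adj c ε π k b = Status.active) (hb' : inPivCluster adj (π.symm k) b)
    (ha : seqStates adj c ε π (k.val + 1) a = Status.active) : cutAt adj c ε π k a b := by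
  have ha' := midState_active_of_succ ha
  refine ⟨hp, ha', hb, Or.inr ⟨hb', fun h => ?_⟩⟩
  rw [seqStates_succ_eq_clustered hp ha' h] at ha
  cases ha

theorem exists_cutAt_of_clustered_ne {a b p q : Fin N}
    (ha : seqStates adj c ε π N a = Status.clustered p)
    (hb : seqStates adj c ε π N b = Status.clustered q) (hpq : p ≠ q) :
    ∃ k, cutAt adj c ε π k a b := by
  wlog hlt : (π p).val < (π q).val generalizing a b p q
  · have hne : (π q).val ≠ (π p).val := fun h => hpq (π.injective (Fin.ext h)).symm
    obtain ⟨k, hk⟩ := this hb ha hpq.symm (by omega)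
    exact ⟨k, cutAt_comm.1 hk⟩
  obtain ⟨h1, h2, h3⟩ := of_clustered le_rfl ha
  obtain ⟨-, h4, -⟩ := of_clustered le_rfl hb
  exact ⟨π p, cutAt_comm.1 (cutAt_of_clustered_of_active (by simpa using h1) h2
    (by simpa [inPivCluster] using h3) (active_of_le hlt (active_of_midState_active h4)))⟩

theorem seqStates_congr {π' : Equiv.Perm (Fin N)} {k : ℕ}
    (h : ∀ j : Fin N, j.val < k → π.symm j = π'.symm j) :
    seqStates adj c ε π k = seqStates adj c ε π' k := by
  induction k with
  | zero => rfl
  | succ k ih =>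
    simp only [seqStates, ih fun j hj => h j (by omega)]
    split_ifs with hk
    · rw [h ⟨k, hk⟩ (Nat.lt_succ_self k)]
    · rfl

/-- A final singleton node was removed at an iteration whose threshold its degree meets. -/
theorem exists_singleton_time {u : Fin N} (h : seqStates adj c ε π N u = Status.singleton) :
    ∃ m : ℕ, m < N ∧ seqStates adj c ε π m u = Status.active ∧
      c / ε * ((N : ℝ) * Real.log N) ≤ (deg adj u : ℝ) * (m + 1 : ℕ) := by
  obtain ⟨m, hm, h1, h2⟩ := exists_deactivation (h ▸ by simp : seqStates adj c ε π N u ≠ _)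
  rcases seqStates_succ_cases (k := ⟨m, hm⟩) h1 h2 with h3 | h3
  · exact ⟨m, hm, h1, h3.2⟩
  · have := seqStates_eq_of_le (Nat.succ_le_of_lt hm) h2
    rw [h, h3.2.2.2] at this
    cases this

theorem lt_threshold_of_active {m j : ℕ} {u : Fin N} (hm : m < N) (hj : j < m)
    (h : seqStates adj c ε π m u = Status.active) :
    (deg adj u : ℝ) * (j + 1 : ℕ) < c / ε * ((N : ℝ) * Real.log N) :=
  (midState_active_iff.1 (midState_active_of_lt hj (hj.trans hm) h)).2

theorem active_of_uncut {a b : Fin N} {m : ℕ} (hm : m < N)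
    (ha : seqStates adj c ε π m a = Status.active) (hdeg : deg adj b ≤ deg adj a)
    (hcut : ¬ ∃ k, cutAt adj c ε π k a b) : seqStates adj c ε π m b = Status.active := by
  by_contra hb
  obtain ⟨j, hj, h1, h2⟩ := exists_deactivation hb
  have haj := lt_threshold_of_active hm hj ha
  rcases seqStates_succ_cases (k := ⟨j, hj.trans hm⟩) h1 h2 with h3 | h3
  · have : (deg adj b : ℝ) * (j + 1 : ℕ) ≤ (deg adj a : ℝ) * (j + 1 : ℕ) := by gcongr
    exact absurd (h3.2.trans this) haj.not_ge
  · exact hcut ⟨_, cutAt_of_clustered_of_active h3.1 h3.2.1 h3.2.2.1 (active_of_le hj ha)⟩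

theorem singleton_of_uncut {a b : Fin N} {m : ℕ} (hm : m < N)
    (ha : seqStates adj c ε π m a = Status.active)
    (hthr : c / ε * ((N : ℝ) * Real.log N) ≤ (deg adj a : ℝ) * (m + 1 : ℕ))
    (hdeg : deg adj a ≤ deg adj b)
    (hcut : ¬ ∃ k, cutAt adj c ε π k a b) : seqStates adj c ε π N b = Status.singleton := by
  have hthr' : c / ε * ((N : ℝ) * Real.log N) ≤ (deg adj b : ℝ) * (m + 1 : ℕ) :=
    hthr.trans (by gcongr)
  have hb : seqStates adj c ε π (m + 1) b ≠ Status.active := fun h =>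
    (midState_active_iff.1 (midState_active_of_succ (k := ⟨m, hm⟩) h)).2.not_ge hthr'
  obtain ⟨j, hj, h1, h2⟩ := exists_deactivation hb
  rcases seqStates_succ_cases (k := ⟨j, by omega⟩) h1 h2 with h3 | h3
  · rw [seqStates_eq_of_le (by omega) h2, h3.1]
  · rcases Nat.lt_succ_iff_lt_or_eq.1 hj with hj | rfl
    · exact absurd ⟨_, cutAt_of_clustered_of_active h3.1 h3.2.1 h3.2.2.1 (active_of_le hj ha)⟩ hcut
    · exact absurd (midState_active_iff.1 h3.2.1).2 hthr'.not_gt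

end Run

section PivotCost

theorem card_filter_symm (R : Fin N → Fin N → Prop) (hs : ∀ a b, R a b → R b a)
    (hi : ∀ a, ¬ R a a) :
    (Finset.univ.filter fun p : Fin N × Fin N => R p.1 p.2).card =
      2 * (Finset.univ.filter fun p : Fin N × Fin N => p.1 < p.2 ∧ R p.1 p.2).card := by
  have h1 : (Finset.univ.filter fun p : Fin N × Fin N => R p.1 p.2) =
      (Finset.univ.filter fun p : Fin N × Fin N => p.1 < p.2 ∧ R p.1 p.2) ∪
      (Finset.univ.filter fun p : Fin N × Fin N => p.2 < p.1 ∧ R p.1 p.2) := by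
    ext ⟨a, b⟩
    simp only [Finset.mem_filter, Finset.mem_univ, true_and, Finset.mem_union]
    rcases lt_trichotomy a b with h | rfl | h
    · simp [h]
    · simp [hi]
    · simp [h]
  have h2 : (Finset.univ.filter fun p : Fin N × Fin N => p.2 < p.1 ∧ R p.1 p.2).card =
      (Finset.univ.filter fun p : Fin N × Fin N => p.1 < p.2 ∧ R p.1 p.2).card := by
    refine Finset.card_bij (fun p _ => p.swap) ?_ ?_ ?_
    · rintro ⟨a, b⟩ h
      simp only [Finset.mem_filter, Finset.mem_univ, true_and] at h
      simpa using ⟨h.1, hs _ _ h.2⟩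
    · rintro p - q - h
      exact Prod.swap_injective h
    · rintro ⟨a, b⟩ h
      simp only [Finset.mem_filter, Finset.mem_univ, true_and] at h
      exact ⟨(b, a), by simpa using ⟨h.1, hs _ _ h.2⟩, rfl⟩
  rw [h1, Finset.card_union_of_disjoint, h2, two_mul]
  rw [Finset.disjoint_filter]
  rintro p - h h'
  exact absurd h.1 h'.1.not_gt

/-- `x, y, z` are distinct and span exactly two positive pairs. -/
def BadTriple (adj : Fin N → Fin N → Bool) (x y z : Fin N) : Prop :=
  x ≠ y ∧ y ≠ z ∧ x ≠ z ∧
    ((adj x y = true ∧ adj y z = true ∧ adj x z = false) ∨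
     (adj x y = true ∧ adj y z = false ∧ adj x z = true) ∨
     (adj x y = false ∧ adj y z = true ∧ adj x z = true))

/-- The bad triple `x, y, z` is hit by the pivot `x` while all three nodes are active. -/
def Hit (adj : Fin N → Fin N → Bool) (c ε : ℝ) (π : Equiv.Perm (Fin N)) (x y z : Fin N) : Prop :=
  BadTriple adj x y z ∧ ∀ v, v = x ∨ v = y ∨ v = z → midState adj c ε π (π x) v = Status.active

/-- The pair `a, b` is a disagreement of the clustering `f`. -/
def Disagree (adj : Fin N → Fin N → Bool) (f : Fin N → Fin N) (a b : Fin N) : Prop :=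
  a ≠ b ∧ ((adj a b = true ∧ f a ≠ f b) ∨ (adj a b = false ∧ f a = f b))

/-- The pair `a, b` is a disagreement induced by a pivot cluster. -/
def PivotDisagree (adj : Fin N → Fin N → Bool) (c ε : ℝ) (π : Equiv.Perm (Fin N))
    (a b : Fin N) : Prop :=
  (adj a b = true ∧ ∃ k : Fin N, cutAt adj c ε π k a b) ∨
    (adj a b = false ∧ ∃ q : Fin N,
      seqStates adj c ε π N a = Status.clustered q ∧ seqStates adj c ε π N b = Status.clustered q)

variable {adj : Fin N → Fin N → Bool} {c ε : ℝ} {π : Equiv.Perm (Fin N)}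

theorem BadTriple.swap_right (hs : ∀ u v, adj u v = adj v u) {x y z : Fin N}
    (h : BadTriple adj x y z) : BadTriple adj x z y := by
  unfold BadTriple at *
  rw [hs z y]
  tauto

theorem BadTriple.swap_left (hs : ∀ u v, adj u v = adj v u) {x y z : Fin N}
    (h : BadTriple adj x y z) : BadTriple adj y x z := by
  unfold BadTriple at *
  rw [hs y x]
  tauto

theorem Hit.swap_right (hs : ∀ u v, adj u v = adj v u) {x y z : Fin N}
    (h : Hit adj c ε π x y z) : Hit adj c ε π x z y :=
  ⟨h.1.swap_right hs, fun v hv => h.2 v (by tauto)⟩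

theorem Hit.swap_left (hs : ∀ u v, adj u v = adj v u) {x y z : Fin N}
    (h : Hit adj c ε π x y z) : Hit adj c ε (Equiv.swap x y * π⁻¹)⁻¹ y x z := by
  refine ⟨h.1.swap_left hs, ?_⟩
  have hpos : (Equiv.swap x y * π⁻¹)⁻¹ y = π x := by simp [Equiv.Perm.mul_apply]
  have hst : seqStates adj c ε (Equiv.swap x y * π⁻¹)⁻¹ (π x) = seqStates adj c ε π (π x) := by
    symm
    refine seqStates_congr fun j hj => ?_
    have e : (Equiv.symm (Equiv.swap x y * π⁻¹)⁻¹) j = Equiv.swap x y (π.symm j) := rfl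
    rw [e, Equiv.swap_apply_of_ne_of_ne]
    · rintro rfl
      simp at hj
    · intro he
      have := le_position_of_active (active_of_midState_active (h.2 y (by simp)))
      rw [← he] at this
      simp only [Equiv.apply_symm_apply] at this
      omega
  rw [hpos]
  intro v hv
  have := h.2 v (by tauto)
  unfold midState at *
  rwa [hst]

theorem Hit.unique {x x' y z : Fin N} (h : Hit adj c ε π x y z) (h' : Hit adj c ε π x' y z) :
    x = x' := by
  wlog hlt : (π x).val < (π x').val generalizing x x'
  · by_contra hne
    have hne' : (π x).val ≠ (π x').val := fun e => hne (π.injective (Fin.ext e))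
    exact hne (this h' h (by omega)).symm
  exfalso
  have hx := h.2 x (by simp)
  have key : ∀ v, v = y ∨ v = z → adj x v = false := by
    intro v hv
    by_contra hav
    have h1 := seqStates_succ_eq_clustered (k := π x) (v := v) (by simpa using hx)
      (h.2 v (by tauto)) (by simp at hav; simp [hav])
    have h2 := active_of_le hlt (active_of_midState_active (h'.2 v (by tauto)))
    rw [h1] at h2
    cases h2
  have hy := key y (by simp)
  have hz := key z (by simp)
  rcases h.1.2.2.2 with h | h | h <;> simp_all

theorem BadTriple.exists_disagree (f : Fin N → Fin N) {x y z : Fin N}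
    (h : BadTriple adj x y z) :
    Disagree adj f y z ∨ Disagree adj f x z ∨ Disagree adj f x y := by
  unfold BadTriple Disagree at *
  grind

theorem PivotDisagree.exists_hit (hs : ∀ u v, adj u v = adj v u) {a b : Fin N} (hab : a ≠ b)
    (h : PivotDisagree adj c ε π a b) : ∃ x, Hit adj c ε π x a b := by
  rcases h with ⟨hadj, k, hp, ha, hb, h⟩ | ⟨hadj, q, ha, hb⟩
  · refine ⟨π.symm k, ?_, ?_⟩
    · unfold inPivCluster at h
      unfold BadTriple
      have := hs a b
      grind
    · rintro v (rfl | rfl | rfl) <;> simpa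
  · obtain ⟨h1, h2, h3⟩ := of_clustered le_rfl ha
    obtain ⟨-, h5, h6⟩ := of_clustered le_rfl hb
    refine ⟨q, ?_, ?_⟩
    · unfold BadTriple
      have := hs a b
      grind
    · rintro v (rfl | rfl | rfl) <;> simpa

theorem two_mul_cost (hs : ∀ u v, adj u v = adj v u) (f : Fin N → Fin N) :
    2 * cost adj f = (Finset.univ.filter fun p : Fin N × Fin N => Disagree adj f p.1 p.2).card := by
  rw [card_filter_symm (Disagree adj f)]
  · refine congrArg (2 * ·) (congrArg Finset.card (Finset.ext fun p => ?_))
    simp only [Finset.mem_filter, Finset.mem_univ, true_and]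
    unfold Disagree
    have := fun h : p.1 < p.2 => h.ne
    tauto
  · intro a b h
    unfold Disagree at *
    have := hs a b
    grind
  · simp [Disagree]

theorem two_mul_Cpivot_le (hs : ∀ u v, adj u v = adj v u) :
    2 * Cpivot adj c ε π ≤
      ∑ x, ∑ y, ∑ z, if Hit adj c ε π x y z then 1 else 0 := by
  have h1 : 2 * Cpivot adj c ε π ≤
      (Finset.univ.filter fun p : Fin N × Fin N => ∃ x, Hit adj c ε π x p.1 p.2).card := by
    refine le_of_le_of_eq ?_ (Eq.trans
      (card_filter_symm (fun a b => ∃ x, Hit adj c ε π x a b) ?_ ?_).symm (by congr))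
    · refine Nat.mul_le_mul_left _ (Finset.card_le_card fun p hp => ?_)
      simp only [Finset.mem_filter, Finset.mem_univ, true_and] at hp ⊢
      exact ⟨hp.1, PivotDisagree.exists_hit hs hp.1.ne hp.2⟩
    · exact fun a b ⟨x, h⟩ => ⟨x, h.swap_right hs⟩
    · exact fun a ⟨x, h⟩ => h.1.2.1 rfl
  refine h1.trans ?_
  rw [Finset.card_filter, Finset.sum_comm' (t' := Finset.univ) (s' := fun _ => Finset.univ) (by simp),
    Fintype.sum_prod_type]
  refine Finset.sum_le_sum fun y _ => ?_
  rw [Finset.sum_comm]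
  refine Finset.sum_le_sum fun z _ => ?_
  split_ifs with h
  · obtain ⟨x, hx⟩ := h
    calc 1 = if Hit adj c ε π x y z then 1 else 0 := by simp [hx]
      _ ≤ _ := Finset.single_le_sum (f := fun x => if Hit adj c ε π x y z then 1 else 0)
        (fun _ _ => Nat.zero_le _) (Finset.mem_univ x)
  · exact Nat.zero_le _

/-- The number of permutations for which `x, y, z` is hit. -/
noncomputable def hitCount (adj : Fin N → Fin N → Bool) (c ε : ℝ) (x y z : Fin N) : ℕ :=
  (Finset.univ.filter fun π : Equiv.Perm (Fin N) => Hit adj c ε π x y z).card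

theorem hitCount_swap_right (hs : ∀ u v, adj u v = adj v u) (x y z : Fin N) :
    hitCount adj c ε x y z = hitCount adj c ε x z y := by
  unfold hitCount
  congr 1
  ext π
  simp only [Finset.mem_filter, Finset.mem_univ, true_and]
  exact ⟨fun h => h.swap_right hs, fun h => h.swap_right hs⟩

theorem hitCount_le_swap_left (hs : ∀ u v, adj u v = adj v u) (x y z : Fin N) :
    hitCount adj c ε x y z ≤ hitCount adj c ε y x z := by
  unfold hitCount
  refine Finset.card_le_card_of_injOn (fun π => (Equiv.swap x y * π⁻¹)⁻¹) ?_ ?_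
  · intro π hπ
    simp only [Finset.coe_filter, Finset.mem_univ, true_and, Set.mem_ofPred_eq] at hπ ⊢
    exact hπ.swap_left hs
  · intro π _ π' _ h
    simpa using h

theorem hitCount_swap_left (hs : ∀ u v, adj u v = adj v u) (x y z : Fin N) :
    hitCount adj c ε x y z = hitCount adj c ε y x z :=
  (hitCount_le_swap_left hs x y z).antisymm (hitCount_le_swap_left hs y x z)

theorem sum_hitCount_le (y z : Fin N) : ∑ x, hitCount adj c ε x y z ≤ Nat.factorial N := by
  unfold hitCount
  simp_rw [Finset.card_filter]
  rw [Finset.sum_comm]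
  calc _ ≤ ∑ π : Equiv.Perm (Fin N), 1 := by
        refine Finset.sum_le_sum fun π _ => ?_
        rw [← Finset.card_filter, Finset.card_le_one]
        intro a ha b hb
        simp only [Finset.mem_filter, Finset.mem_univ, true_and] at ha hb
        exact ha.unique hb
    _ = _ := by simp [Fintype.card_perm]

/-- The pivot clusters alone are a 3-approximation in expectation. -/
theorem sum_Cpivot_le (hs : ∀ u v, adj u v = adj v u) (f : Fin N → Fin N) :
    ∑ π, Cpivot adj c ε π ≤ 3 * cost adj f * Nat.factorial N := by
  set T := hitCount adj c ε with hT
  set d : Fin N → Fin N → ℕ := fun a b => if Disagree adj f a b then 1 else 0 with hd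
  have h1 : 2 * ∑ π, Cpivot adj c ε π ≤ ∑ x, ∑ y, ∑ z, T x y z := by
    rw [Finset.mul_sum]
    refine (Finset.sum_le_sum fun π _ => two_mul_Cpivot_le hs).trans (le_of_eq ?_)
    simp_rw [hT, hitCount, Finset.card_filter]
    rw [Finset.sum_comm]
    refine Finset.sum_congr rfl fun x _ => ?_
    rw [Finset.sum_comm]
    refine Finset.sum_congr rfl fun y _ => ?_
    rw [Finset.sum_comm]
  have h2 : ∀ x y z, T x y z ≤ T x y z * d y z + T x y z * d x z + T x y z * d x y := by
    intro x y z
    rcases Nat.eq_zero_or_pos (T x y z) with h0 | h0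
    · simp [h0]
    · obtain ⟨π, hπ⟩ := Finset.card_pos.1 h0
      simp only [Finset.mem_filter, Finset.mem_univ, true_and] at hπ
      rw [← mul_add, ← mul_add]
      refine Nat.le_mul_of_pos_right _ ?_
      rcases hπ.1.exists_disagree f with h | h | h <;> simp only [hd, if_pos h] <;> omega
  have h3 : ∑ x, ∑ y, ∑ z, T x y z * d x z = ∑ x, ∑ y, ∑ z, T x y z * d y z := by
    rw [Finset.sum_comm]
    simp_rw [hT, hitCount_swap_left hs]
  have h4 : ∑ x, ∑ y, ∑ z, T x y z * d x y = ∑ x, ∑ y, ∑ z, T x y z * d x z := by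
    refine Finset.sum_congr rfl fun x _ => ?_
    rw [Finset.sum_comm]
    refine Finset.sum_congr rfl fun y _ => Finset.sum_congr rfl fun z _ => ?_
    rw [hT, hitCount_swap_right hs]
  have h5 : ∑ x, ∑ y, ∑ z, T x y z * d y z ≤ 2 * cost adj f * Nat.factorial N := by
    rw [two_mul_cost hs, Finset.card_filter, Fintype.sum_prod_type, Finset.sum_mul, Finset.sum_comm]
    refine Finset.sum_le_sum fun y _ => ?_
    rw [Finset.sum_comm, Finset.sum_mul]
    refine Finset.sum_le_sum fun z _ => ?_
    rw [← Finset.sum_mul, mul_comm]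
    exact Nat.mul_le_mul_left _ (sum_hitCount_le y z)
  have h6 : ∑ x, ∑ y, ∑ z, T x y z ≤ 3 * ∑ x, ∑ y, ∑ z, T x y z * d y z := by
    calc _ ≤ ∑ x, ∑ y, ∑ z, (T x y z * d y z + T x y z * d x z + T x y z * d x y) :=
          Finset.sum_le_sum fun x _ => Finset.sum_le_sum fun y _ => Finset.sum_le_sum fun z _ =>
            h2 x y z
      _ = _ := by
          simp_rw [Finset.sum_add_distrib]
          rw [h4, h3]
          ring
  nlinarith

end PivotCost

section Survival

/-- The active positive neighbors of `u` of degree at most that of `u`, after `m` iterations. -/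
noncomputable def lowActive (adj : Fin N → Fin N → Bool) (c ε : ℝ) (π : Equiv.Perm (Fin N))
    (m : ℕ) (u : Fin N) : Finset (Fin N) :=
  Finset.univ.filter fun v =>
    adj u v = true ∧ deg adj v ≤ deg adj u ∧ seqStates adj c ε π m v = Status.active

/-- After `m` iterations `u` is active and has more than `ε · deg u` active neighbors of at most
its own degree. -/
def Survives (adj : Fin N → Fin N → Bool) (c ε : ℝ) (π : Equiv.Perm (Fin N)) (m : ℕ)
    (u : Fin N) : Prop :=
  seqStates adj c ε π m u = Status.active ∧ ε * deg adj u < (lowActive adj c ε π m u).card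

/-- The permutations for which `u` survives `m` iterations. -/
noncomputable def surviving (adj : Fin N → Fin N → Bool) (c ε : ℝ) (m : ℕ) (u : Fin N) :
    Finset (Equiv.Perm (Fin N)) :=
  Finset.univ.filter fun π => Survives adj c ε π m u

variable {adj : Fin N → Fin N → Bool} {c ε : ℝ} {π : Equiv.Perm (Fin N)}

theorem deg_lt (hi : ∀ u, adj u u = false) (u : Fin N) : deg adj u < N := by
  have : deg adj u < (Finset.univ : Finset (Fin N)).card := by
    refine Finset.card_lt_card (Finset.filter_ssubset.2 ⟨u, Finset.mem_univ u, by simp [hi]⟩)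
  simpa using this

theorem Survives.of_succ (hs : ∀ u v, adj u v = adj v u) {k u : Fin N}
    (hthr : (deg adj u : ℝ) * (k.val + 1 : ℕ) < c / ε * ((N : ℝ) * Real.log N))
    (h : Survives adj c ε π (k.val + 1) u) :
    Survives adj c ε π k u ∧ π.symm k ∉ lowActive adj c ε π k u := by
  refine ⟨⟨active_of_le (Nat.le_succ _) h.1, h.2.trans_le ?_⟩, fun hk => ?_⟩
  · refine Nat.cast_le.2 (Finset.card_le_card fun v hv => ?_)
    simp only [lowActive, Finset.mem_filter, Finset.mem_univ, true_and] at hv ⊢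
    exact ⟨hv.1, hv.2.1, active_of_le (Nat.le_succ _) hv.2.2⟩
  · simp only [lowActive, Finset.mem_filter, Finset.mem_univ, true_and] at hk
    have hmid : midState adj c ε π k (π.symm k) = Status.active :=
      midState_active_iff.2 ⟨hk.2.2, lt_of_le_of_lt (by gcongr; exact hk.2.1) hthr⟩
    have h1 := seqStates_succ_eq_clustered hmid (midState_active_of_succ h.1)
      (Or.inr (by rw [hs]; exact hk.1))
    rw [h.1] at h1
    cases h1

theorem Survives.swap {j k u : Fin N} (h : Survives adj c ε π k u)
    (hj : π.symm j ∈ lowActive adj c ε π k u) :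
    Survives adj c ε (π⁻¹ * Equiv.swap k j)⁻¹ k u ∧
      (π⁻¹ * Equiv.swap k j)⁻¹.symm k ∈ lowActive adj c ε (π⁻¹ * Equiv.swap k j)⁻¹ k u := by
  have e : ∀ i, (π⁻¹ * Equiv.swap k j)⁻¹.symm i = π.symm (Equiv.swap k j i) := fun i => rfl
  have hkj : k.val ≤ j.val := by
    simp only [lowActive, Finset.mem_filter, Finset.mem_univ, true_and] at hj
    simpa using le_position_of_active hj.2.2
  have hst : seqStates adj c ε (π⁻¹ * Equiv.swap k j)⁻¹ k = seqStates adj c ε π k := by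
    symm
    refine seqStates_congr fun i hi => ?_
    rw [e, Equiv.swap_apply_of_ne_of_ne]
    · rintro rfl
      omega
    · rintro rfl
      omega
  rw [e, Equiv.swap_apply_left]
  unfold Survives lowActive at *
  rw [hst]
  exact ⟨h, hj⟩

theorem card_surviving_mul_le (k u : Fin N) :
    ε * deg adj u * (surviving adj c ε k u).card ≤
      N * ((surviving adj c ε k u).filter fun π =>
        π.symm k ∈ lowActive adj c ε π k u).card := by
  set H := (surviving adj c ε k u).filter fun π => π.symm k ∈ lowActive adj c ε π k u with hH
  have h1 : ∀ j, ((surviving adj c ε k u).filter fun π =>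
      π.symm j ∈ lowActive adj c ε π k u).card ≤ H.card := by
    intro j
    refine Finset.card_le_card_of_injOn (fun π => (π⁻¹ * Equiv.swap k j)⁻¹) ?_ ?_
    · intro π hπ
      simp only [surviving, hH, Finset.coe_filter, Finset.mem_filter, Finset.mem_univ, true_and,
        Set.mem_ofPred_eq] at hπ ⊢
      exact hπ.1.swap hπ.2
    · intro π _ π' _ h
      simpa using h
  have h2 : ∑ π ∈ surviving adj c ε k u, (lowActive adj c ε π k u).card ≤ N * H.card := by
    calc _ = ∑ π ∈ surviving adj c ε k u, ∑ j,
          if π.symm j ∈ lowActive adj c ε π k u then 1 else 0 := by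
          refine Finset.sum_congr rfl fun π _ => ?_
          rw [Equiv.sum_comp π.symm (fun v => if v ∈ lowActive adj c ε π k u then 1 else 0)]
          simp
      _ = ∑ j, ((surviving adj c ε k u).filter fun π =>
            π.symm j ∈ lowActive adj c ε π k u).card := by
          rw [Finset.sum_comm]
          simp_rw [Finset.card_filter]
      _ ≤ ∑ _j : Fin N, H.card := Finset.sum_le_sum fun j _ => h1 j
      _ = _ := by simp
  calc _ = ∑ π ∈ surviving adj c ε k u, ε * deg adj u := by
        rw [Finset.sum_const, nsmul_eq_mul, mul_comm]
    _ ≤ ∑ π ∈ surviving adj c ε k u, ((lowActive adj c ε π k u).card : ℝ) := by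
        refine Finset.sum_le_sum fun π hπ => ?_
        simp only [surviving, Finset.mem_filter, Finset.mem_univ, true_and] at hπ
        exact hπ.2.le
    _ ≤ _ := by exact_mod_cast h2

theorem card_surviving_succ_le (hs : ∀ u v, adj u v = adj v u) {k u : Fin N}
    (hthr : (deg adj u : ℝ) * (k.val + 1 : ℕ) < c / ε * ((N : ℝ) * Real.log N)) :
    ((surviving adj c ε (k.val + 1) u).card : ℝ) ≤
      (1 - ε * deg adj u / N) * (surviving adj c ε k u).card := by
  have hN : (0 : ℝ) < N := by exact_mod_cast k.pos
  have h1 := card_surviving_mul_le (adj := adj) (c := c) (ε := ε) k u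
  set H := (surviving adj c ε k u).filter fun π => π.symm k ∈ lowActive adj c ε π k u with hH
  have h2 : (surviving adj c ε (k.val + 1) u).card + H.card ≤ (surviving adj c ε k u).card := by
    rw [← Finset.card_filter_add_card_filter_not (s := surviving adj c ε k u)
      (fun π => π.symm k ∈ lowActive adj c ε π k u), add_comm]
    refine Nat.add_le_add_left (Finset.card_le_card fun π hπ => ?_) _
    simp only [surviving, Finset.mem_filter, Finset.mem_univ, true_and] at hπ ⊢
    exact hπ.of_succ hs hthr
  have h2' : ((surviving adj c ε (k.val + 1) u).card : ℝ) + H.card ≤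
    (surviving adj c ε k u).card := by exact_mod_cast h2
  have h3 : ε * deg adj u / N * (surviving adj c ε k u).card ≤ H.card := by
    rw [div_mul_eq_mul_div, div_le_iff₀ hN]
    linarith
  linarith

theorem card_surviving_le_pow (hs : ∀ u v, adj u v = adj v u) (hi : ∀ u, adj u u = false)
    (hε1 : ε ≤ 1) {u : Fin N} (m : ℕ) (hm : m ≤ N)
    (hthr : ∀ j < m, (deg adj u : ℝ) * (j + 1 : ℕ) < c / ε * ((N : ℝ) * Real.log N)) :
    ((surviving adj c ε m u).card : ℝ) ≤ (1 - ε * deg adj u / N) ^ m * Nat.factorial N := by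
  have hN : (0 : ℝ) < N := by exact_mod_cast u.pos
  have hd : (deg adj u : ℝ) ≤ N := by exact_mod_cast (deg_lt hi u).le
  have h0 : 0 ≤ 1 - ε * deg adj u / N := by
    rw [sub_nonneg, div_le_one hN]
    nlinarith [Nat.cast_nonneg (α := ℝ) (deg adj u)]
  induction m with
  | zero =>
    have : (surviving adj c ε 0 u).card ≤ Nat.factorial N :=
      (Finset.card_le_univ _).trans (by simp [Fintype.card_perm])
    simpa using this
  | succ m ih =>
    calc _ ≤ (1 - ε * deg adj u / N) * (surviving adj c ε m u).card :=
          card_surviving_succ_le hs (k := ⟨m, hm⟩) (hthr m m.lt_succ_self)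
      _ ≤ (1 - ε * deg adj u / N) * ((1 - ε * deg adj u / N) ^ m * Nat.factorial N) :=
          mul_le_mul_of_nonneg_left (ih (by omega) fun j hj => hthr j (by omega)) h0
      _ = _ := by ring

/-- At the iteration whose threshold `deg u` meets first, survival has probability at most
`N ^ (-c/2)`. -/
theorem card_surviving_le (hc : 2 ≤ c) (hε0 : 0 < ε) (hε1 : ε ≤ 1)
    (hs : ∀ u v, adj u v = adj v u) (hi : ∀ u, adj u u = false) (hN2 : 2 ≤ N)
    {u : Fin N} (m : ℕ) (hm : m ≤ N)
    (hthr : ∀ j < m, (deg adj u : ℝ) * (j + 1 : ℕ) < c / ε * ((N : ℝ) * Real.log N))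
    (hthr' : c / ε * ((N : ℝ) * Real.log N) ≤ (deg adj u : ℝ) * (m + 1 : ℕ)) :
    ((surviving adj c ε m u).card : ℝ) ≤ (N : ℝ) ^ (-(c / 2)) * Nat.factorial N := by
  have hN : (0 : ℝ) < N := by exact_mod_cast u.pos
  have hdN : (deg adj u : ℝ) < N := by exact_mod_cast (deg_lt hi u)
  have hlog : Real.log 2 ≤ Real.log N := Real.log_le_log two_pos (by exact_mod_cast hN2)
  have hlog2 := Real.log_two_gt_d9
  have hce : 2 ≤ c / ε := by rw [le_div_iff₀ hε0]; nlinarith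
  have hm1 : 1 ≤ m := by
    by_contra! h
    obtain rfl : m = 0 := by omega
    have h1 : 1 ≤ c / ε * Real.log N := by nlinarith
    have h2 : (N : ℝ) ≤ c / ε * (N * Real.log N) := by nlinarith
    simp only [zero_add, Nat.cast_one, mul_one] at hthr'
    linarith
  have hm1' : (1 : ℝ) ≤ m := by exact_mod_cast hm1
  refine (card_surviving_le_pow hs hi hε1 m hm hthr).trans ?_
  gcongr
  have hd : (0 : ℝ) ≤ deg adj u := Nat.cast_nonneg _
  have hx : 0 ≤ 1 - ε * deg adj u / N := by
    rw [sub_nonneg, div_le_one hN]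
    nlinarith
  calc (1 - ε * deg adj u / N) ^ m ≤ Real.exp (-(ε * deg adj u / N)) ^ m := by
        gcongr
        have := Real.add_one_le_exp (-(ε * deg adj u / N))
        linarith
    _ = Real.exp (m * -(ε * deg adj u / N)) := by rw [← Real.exp_nat_mul]
    _ ≤ Real.exp (Real.log N * -(c / 2)) := by
        refine Real.exp_le_exp.2 ?_
        have h1 : c * (N * Real.log N) ≤ ε * (deg adj u * (m + 1 : ℕ)) := by
          have := mul_le_mul_of_nonneg_left hthr' hε0.le
          rwa [← mul_assoc, mul_div_cancel₀ _ hε0.ne'] at this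
        push_cast at h1
        have h2 : Real.log N * (c / 2) ≤ m * (ε * deg adj u / N) := by
          rw [← mul_div_assoc (m : ℝ), le_div_iff₀ hN]
          have : 0 ≤ ε * deg adj u := by positivity
          nlinarith
        linarith
    _ = (N : ℝ) ^ (-(c / 2)) := by rw [Real.rpow_def_of_pos hN]

end Survival

section Cost

/-- `u` survives until the first iteration whose threshold its degree meets. -/
def Fails (adj : Fin N → Fin N → Bool) (c ε : ℝ) (π : Equiv.Perm (Fin N)) (u : Fin N) : Prop :=
  ∃ m < N, (∀ j < m, (deg adj u : ℝ) * (j + 1 : ℕ) < c / ε * ((N : ℝ) * Real.log N)) ∧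
    c / ε * ((N : ℝ) * Real.log N) ≤ (deg adj u : ℝ) * (m + 1 : ℕ) ∧ Survives adj c ε π m u

/-- A positive pair with an endpoint in a singleton cluster that no pivot cluster cuts. -/
def UncutSingleton (adj : Fin N → Fin N → Bool) (c ε : ℝ) (π : Equiv.Perm (Fin N))
    (a b : Fin N) : Prop :=
  adj a b = true ∧ (seqStates adj c ε π N a = Status.singleton ∨
    seqStates adj c ε π N b = Status.singleton) ∧ ¬ ∃ k, cutAt adj c ε π k a b

/-- The number of positive pairs with an endpoint in a singleton cluster that no pivot cluster
cuts. -/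
noncomputable def uncutCount (adj : Fin N → Fin N → Bool) (c ε : ℝ) (π : Equiv.Perm (Fin N)) :
    ℕ :=
  (Finset.univ.filter fun p : Fin N × Fin N => p.1 < p.2 ∧ UncutSingleton adj c ε π p.1 p.2).card

/-- `u` ends up as a singleton, and `v` is an active neighbor of at most its degree at the time `u`
is removed. -/
def Charged (adj : Fin N → Fin N → Bool) (c ε : ℝ) (π : Equiv.Perm (Fin N)) (u v : Fin N) : Prop :=
  seqStates adj c ε π N u = Status.singleton ∧ ∃ m < N, seqStates adj c ε π m u = Status.active ∧
    c / ε * ((N : ℝ) * Real.log N) ≤ (deg adj u : ℝ) * (m + 1 : ℕ) ∧ v ∈ lowActive adj c ε π m u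

variable {adj : Fin N → Fin N → Bool} {c ε : ℝ} {π : Equiv.Perm (Fin N)}

theorem UncutSingleton.symm (hs : ∀ u v, adj u v = adj v u) {a b : Fin N}
    (h : UncutSingleton adj c ε π a b) : UncutSingleton adj c ε π b a :=
  ⟨by rw [hs]; exact h.1, h.2.1.symm, fun ⟨k, hk⟩ => h.2.2 ⟨k, cutAt_comm.1 hk⟩⟩

theorem card_fails_le (hc : 2 ≤ c) (hε0 : 0 < ε) (hε1 : ε ≤ 1)
    (hs : ∀ u v, adj u v = adj v u) (hi : ∀ u, adj u u = false) (hN2 : 2 ≤ N) (u : Fin N) :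
    ((Finset.univ.filter fun π => Fails adj c ε π u).card : ℝ) ≤
      (N : ℝ) ^ (-(c / 2)) * Nat.factorial N := by
  by_cases h : ∃ m < N,
      (∀ j < m, (deg adj u : ℝ) * (j + 1 : ℕ) < c / ε * ((N : ℝ) * Real.log N)) ∧
      c / ε * ((N : ℝ) * Real.log N) ≤ (deg adj u : ℝ) * (m + 1 : ℕ)
  · obtain ⟨m, hm, h1, h2⟩ := h
    refine le_trans ?_ (card_surviving_le hc hε0 hε1 hs hi hN2 m hm.le h1 h2)
    refine Nat.cast_le.2 (Finset.card_le_card fun π hπ => ?_)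
    simp only [surviving, Finset.mem_filter, Finset.mem_univ, true_and] at hπ ⊢
    obtain ⟨m', -, h3, h4, h5⟩ := hπ
    obtain rfl : m' = m := by
      rcases lt_trichotomy m' m with hlt | heq | hlt
      · exact absurd h4 (h1 m' hlt).not_ge
      · exact heq
      · exact absurd h2 (h3 m hlt).not_ge
    exact h5
  · have : (Finset.univ.filter fun π => Fails adj c ε π u) = ∅ := by
      rw [Finset.filter_eq_empty_iff]
      rintro π - ⟨m, hm, h1, h2, -⟩
      exact h ⟨m, hm, h1, h2⟩
    rw [this, Finset.card_empty, Nat.cast_zero]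
    positivity

theorem cost_le :
    cost adj (seqLabel adj c ε π) ≤ Cpivot adj c ε π + uncutCount adj c ε π := by
  unfold cost Cpivot uncutCount
  refine (Finset.card_le_card ?_).trans (Finset.card_union_le _ _)
  rintro ⟨a, b⟩ h
  simp only [Finset.mem_filter, Finset.mem_univ, true_and, Finset.mem_union] at h ⊢
  obtain ⟨hab, h⟩ := h
  rcases h with ⟨hadj, hne⟩ | ⟨hadj, heq⟩
  · by_cases hcut : ∃ k, cutAt adj c ε π k a b
    · exact Or.inl ⟨hab, Or.inl ⟨hadj, hcut⟩⟩
    · refine Or.inr ⟨hab, hadj, ?_, hcut⟩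
      by_contra! hsing
      obtain ⟨p, hp⟩ : ∃ p, seqStates adj c ε π N a = Status.clustered p := by
        rcases h : seqStates adj c ε π N a with _ | _ | p
        exacts [absurd h (final_ne_active a), absurd h hsing.1, ⟨p, rfl⟩]
      obtain ⟨q, hq⟩ : ∃ p, seqStates adj c ε π N b = Status.clustered p := by
        rcases h : seqStates adj c ε π N b with _ | _ | p
        exacts [absurd h (final_ne_active b), absurd h hsing.2, ⟨p, rfl⟩]
      simp only [seqLabel, hp, hq] at hne
      exact hcut (exists_cutAt_of_clustered_ne hp hq hne)
  · refine Or.inl ⟨hab, Or.inr ⟨hadj, ?_⟩⟩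
    unfold seqLabel at heq
    rcases ha : seqStates adj c ε π N a with _ | _ | p
    · exact absurd ha (final_ne_active a)
    · rcases hb : seqStates adj c ε π N b with _ | _ | q
      · exact absurd hb (final_ne_active b)
      · simp only [ha, hb] at heq
        exact absurd heq hab.ne
      · simp only [ha, hb] at heq
        have := clustered_self le_rfl hb
        rw [← heq, ha] at this
        cases this
    · rcases hb : seqStates adj c ε π N b with _ | _ | q
      · exact absurd hb (final_ne_active b)
      · simp only [ha, hb] at heq
        have := clustered_self le_rfl ha
        rw [heq, hb] at this
        cases this
      · simp only [ha, hb] at heq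
        exact ⟨p, rfl, by rw [heq]⟩

theorem sum_deg_singleton_le (hs : ∀ u v, adj u v = adj v u) (hi : ∀ u, adj u u = false) :
    ∑ u ∈ Finset.univ.filter (fun u => seqStates adj c ε π N u = Status.singleton), deg adj u ≤
      2 * (Cpivot adj c ε π + uncutCount adj c ε π) := by
  set R : Fin N → Fin N → Prop := fun a b => adj a b = true ∧
    (seqStates adj c ε π N a = Status.singleton ∨ seqStates adj c ε π N b = Status.singleton)
    with hR
  calc _ ≤ (Finset.univ.filter fun p : Fin N × Fin N => R p.1 p.2).card := by
        rw [Finset.card_filter, Fintype.sum_prod_type, Finset.sum_filter]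
        refine Finset.sum_le_sum fun u _ => ?_
        split_ifs with hu
        · rw [deg, ← Finset.card_filter]
          refine Finset.card_le_card fun v hv => ?_
          simp only [Finset.mem_filter, Finset.mem_univ, true_and] at hv ⊢
          exact ⟨hv, Or.inl hu⟩
        · exact Nat.zero_le _
    _ = 2 * (Finset.univ.filter fun p : Fin N × Fin N => p.1 < p.2 ∧ R p.1 p.2).card := by
        refine Eq.trans (by congr) ((card_filter_symm R
          (fun a b h => ⟨by rw [hs]; exact h.1, h.2.symm⟩) fun a h => ?_).trans (by congr))
        have := h.1
        rw [hi] at this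
        cases this
    _ ≤ _ := by
        refine Nat.mul_le_mul_left _ ((Finset.card_le_card ?_).trans (Finset.card_union_le _ _))
        rintro ⟨a, b⟩ h
        simp only [Finset.mem_filter, Finset.mem_univ, true_and, Finset.mem_union] at h ⊢
        obtain ⟨hab, hadj, hsing⟩ := h
        by_cases hcut : ∃ k, cutAt adj c ε π k a b
        · exact Or.inl ⟨hab, Or.inl ⟨hadj, hcut⟩⟩
        · exact Or.inr ⟨hab, hadj, hsing, hcut⟩

theorem UncutSingleton.charged (hs : ∀ u v, adj u v = adj v u) {a b : Fin N}
    (h : UncutSingleton adj c ε π a b) : Charged adj c ε π a b ∨ Charged adj c ε π b a := by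
  wlog hdeg : deg adj b ≤ deg adj a generalizing a b
  · exact (this (h.symm hs) (by omega)).symm
  left
  have hsing : seqStates adj c ε π N a = Status.singleton := by
    rcases h.2.1 with ha | hb
    · exact ha
    · obtain ⟨m, hm, h1, h2⟩ := exists_singleton_time hb
      exact singleton_of_uncut hm h1 h2 hdeg (h.symm hs).2.2
  obtain ⟨m, hm, h1, h2⟩ := exists_singleton_time hsing
  refine ⟨hsing, m, hm, h1, h2, ?_⟩
  simp only [lowActive, Finset.mem_filter, Finset.mem_univ, true_and]
  exact ⟨h.1, hdeg, active_of_uncut hm h1 hdeg h.2.2⟩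

theorem uncutCount_le (hs : ∀ u v, adj u v = adj v u) (hi : ∀ u, adj u u = false) :
    uncutCount adj c ε π ≤
      ∑ u, (Finset.univ.filter fun v => Charged adj c ε π u v).card := by
  have h1 : 2 * uncutCount adj c ε π ≤
      2 * (Finset.univ.filter fun p : Fin N × Fin N => Charged adj c ε π p.1 p.2).card := by
    have h := card_filter_symm (UncutSingleton adj c ε π) (fun a b h => h.symm hs)
      (fun a h => by have := h.1; rw [hi] at this; cases this)
    rw [uncutCount, ← h, two_mul]
    have h2 : (Finset.univ.filter fun p : Fin N × Fin N => Charged adj c ε π p.2 p.1).card =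
        (Finset.univ.filter fun p : Fin N × Fin N => Charged adj c ε π p.1 p.2).card :=
      Finset.card_equiv (Equiv.prodComm _ _) (by simp)
    nth_rewrite 2 [← h2]
    refine (Finset.card_le_card fun p hp => ?_).trans (Finset.card_union_le _ _)
    simp only [Finset.mem_filter, Finset.mem_univ, true_and, Finset.mem_union] at hp ⊢
    exact hp.charged hs
  have h2 := Nat.le_of_mul_le_mul_left h1 two_pos
  refine h2.trans (le_of_eq ?_)
  rw [Finset.card_filter, Fintype.sum_prod_type]
  simp_rw [Finset.card_filter]

theorem card_charged_le (hε0 : 0 < ε) (u : Fin N) :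
    ((Finset.univ.filter fun v => Charged adj c ε π u v).card : ℝ) ≤
      ε * (if seqStates adj c ε π N u = Status.singleton then deg adj u else 0 : ℕ) +
        N * (if Fails adj c ε π u then 1 else 0 : ℕ) := by
  by_cases hu : seqStates adj c ε π N u = Status.singleton
  · rw [if_pos hu]
    by_cases hF : Fails adj c ε π u
    · rw [if_pos hF]
      have h1 : (Finset.univ.filter fun v => Charged adj c ε π u v).card ≤ N :=
        (Finset.card_le_univ _).trans (by simp)
      have h1' : ((Finset.univ.filter fun v => Charged adj c ε π u v).card : ℝ) ≤ N := by
        exact_mod_cast h1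
      have : 0 ≤ ε * (deg adj u : ℝ) := by positivity
      push_cast
      linarith
    · rw [if_neg hF]
      obtain ⟨m, hm, h1, h2⟩ := exists_singleton_time hu
      have h3 : ((lowActive adj c ε π m u).card : ℝ) ≤ ε * deg adj u := by
        by_contra! hlt
        exact hF ⟨m, hm, fun j hj => lt_threshold_of_active hm hj h1, h2, h1, hlt⟩
      have h4 : (Finset.univ.filter fun v => Charged adj c ε π u v).card ≤
          (lowActive adj c ε π m u).card := by
        refine Finset.card_le_card fun v hv => ?_
        simp only [Finset.mem_filter, Finset.mem_univ, true_and] at hv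
        obtain ⟨-, m', hm', h5, h6, h7⟩ := hv
        rcases lt_trichotomy m' m with hlt | rfl | hlt
        · exact absurd h6 (lt_threshold_of_active hm hlt h1).not_ge
        · exact h7
        · exact absurd h2 (lt_threshold_of_active hm' hlt h5).not_ge
      have h4' : ((Finset.univ.filter fun v => Charged adj c ε π u v).card : ℝ) ≤
        (lowActive adj c ε π m u).card := by exact_mod_cast h4
      simpa using h4'.trans h3
  · have : (Finset.univ.filter fun v => Charged adj c ε π u v) = ∅ := by
      rw [Finset.filter_eq_empty_iff]
      exact fun v _ h => hu h.1
    rw [this, Finset.card_empty, Nat.cast_zero]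
    positivity

/-- Up to failures, the cost is at most `1 + 4ε` times the cost of the pivot clusters. -/
theorem cost_le_Cpivot (hε0 : 0 < ε) (hε : ε < 1 / 4)
    (hs : ∀ u v, adj u v = adj v u) (hi : ∀ u, adj u u = false) :
    (cost adj (seqLabel adj c ε π) : ℝ) ≤ (1 + 4 * ε) * Cpivot adj c ε π +
      (1 + 4 * ε) * N * ∑ u, ((if Fails adj c ε π u then 1 else 0 : ℕ) : ℝ) := by
  have h1 : (cost adj (seqLabel adj c ε π) : ℝ) ≤ Cpivot adj c ε π + uncutCount adj c ε π := by
    exact_mod_cast cost_le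
  have hdeg : ((∑ u ∈ Finset.univ.filter (fun u => seqStates adj c ε π N u = Status.singleton),
      deg adj u : ℕ) : ℝ) ≤ 2 * (Cpivot adj c ε π + uncutCount adj c ε π) := by
    exact_mod_cast sum_deg_singleton_le hs hi
  have hcharge : (uncutCount adj c ε π : ℝ) ≤
      ∑ u, ((Finset.univ.filter fun v => Charged adj c ε π u v).card : ℝ) := by
    exact_mod_cast uncutCount_le hs hi
  set C : ℝ := (Cpivot adj c ε π : ℝ)
  set B : ℝ := (uncutCount adj c ε π : ℝ)
  set F : ℝ := ∑ u, ((if Fails adj c ε π u then 1 else 0 : ℕ) : ℝ) with hF_def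
  have h2 : B ≤ ε * (2 * (C + B)) + N * F := by
    calc B ≤ _ := hcharge
      _ ≤ _ := Finset.sum_le_sum fun u _ => card_charged_le hε0 u
      _ = ε * ((∑ u ∈ Finset.univ.filter
            (fun u => seqStates adj c ε π N u = Status.singleton), deg adj u : ℕ) : ℝ) + N * F := by
          rw [Finset.sum_add_distrib, ← Finset.mul_sum, ← Finset.mul_sum, Finset.sum_filter,
            hF_def, Nat.cast_sum]
      _ ≤ _ := by gcongr
  have hC : 0 ≤ C := Nat.cast_nonneg _
  have hB0 : 0 ≤ B := Nat.cast_nonneg _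
  have hF : 0 ≤ N * F := mul_nonneg (Nat.cast_nonneg _)
    (Finset.sum_nonneg fun _ _ => Nat.cast_nonneg _)
  have h3 : B * (1 - 2 * ε) ≤ 2 * ε * C + N * F := by linarith
  have h4 : 1 ≤ (1 + 4 * ε) * (1 - 2 * ε) := by nlinarith
  have h5 : B ≤ (1 + 4 * ε) * (2 * ε * C + N * F) := by
    have := mul_le_mul_of_nonneg_left h3 (by positivity : 0 ≤ 1 + 4 * ε)
    nlinarith
  have h6 : (1 + 4 * ε) * (2 * ε * C) ≤ 4 * ε * C := by
    have : 0 ≤ ε * C := by positivity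
    nlinarith
  linarith

theorem exists_cost_eq_OPT (adj : Fin N → Fin N → Bool) : ∃ f, cost adj f = OPT adj :=
  Nat.sInf_mem (s := Set.range (cost adj)) ⟨cost adj id, id, rfl⟩

theorem Ex_cost_le (hc : 2 ≤ c) (hε0 : 0 < ε) (hε : ε < 1 / 4) (hN2 : 2 ≤ N)
    (hs : ∀ u v, adj u v = adj v u) (hi : ∀ u, adj u u = false) :
    Ex N (fun π => (cost adj (seqLabel adj c ε π) : ℝ)) ≤
      (3 + 12 * ε) * (OPT adj : ℝ) + (1 + 4 * ε) * (N : ℝ) ^ ((3 : ℝ) - c / 2) := by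
  have hfact : (0 : ℝ) < Nat.factorial N := by exact_mod_cast Nat.factorial_pos N
  have hN : (1 : ℝ) ≤ N := by exact_mod_cast (by omega : 1 ≤ N)
  have hN0 : (0 : ℝ) < N := by linarith
  obtain ⟨f, hf⟩ := exists_cost_eq_OPT adj
  have h1 : ∑ π, (Cpivot adj c ε π : ℝ) ≤ 3 * OPT adj * Nat.factorial N := by
    rw [← hf]
    exact_mod_cast sum_Cpivot_le hs f
  have h2 : ∑ π : Equiv.Perm (Fin N), ∑ u, ((if Fails adj c ε π u then 1 else 0 : ℕ) : ℝ) ≤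
      N * ((N : ℝ) ^ (-(c / 2)) * Nat.factorial N) := by
    rw [Finset.sum_comm]
    calc _ = ∑ u, ((Finset.univ.filter fun π => Fails adj c ε π u).card : ℝ) := by
          simp_rw [Finset.card_filter]
          push_cast
          rfl
      _ ≤ ∑ _u : Fin N, ((N : ℝ) ^ (-(c / 2)) * Nat.factorial N) :=
          Finset.sum_le_sum fun u _ => card_fails_le hc hε0 (by linarith) hs hi hN2 u
      _ = _ := by simp
  have h3 : (N : ℝ) * (N * (N : ℝ) ^ (-(c / 2))) ≤ (N : ℝ) ^ ((3 : ℝ) - c / 2) := by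
    rw [sub_eq_add_neg, Real.rpow_add hN0]
    have : (N : ℝ) ^ (3 : ℝ) = N ^ 3 := by exact_mod_cast Real.rpow_natCast (N : ℝ) 3
    rw [this, ← mul_assoc]
    gcongr
    nlinarith [mul_pos hN0 hN0]
  rw [Ex, div_le_iff₀ hfact]
  calc _ ≤ ∑ π : Equiv.Perm (Fin N), ((1 + 4 * ε) * (Cpivot adj c ε π : ℝ) +
        (1 + 4 * ε) * N * ∑ u, ((if Fails adj c ε π u then 1 else 0 : ℕ) : ℝ)) :=
        Finset.sum_le_sum fun π _ => cost_le_Cpivot hε0 hε hs hi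
    _ ≤ (1 + 4 * ε) * (3 * OPT adj * Nat.factorial N) +
        (1 + 4 * ε) * N * (N * ((N : ℝ) ^ (-(c / 2)) * Nat.factorial N)) := by
        rw [Finset.sum_add_distrib, ← Finset.mul_sum, ← Finset.mul_sum]
        gcongr
    _ = ((3 + 12 * ε) * OPT adj + (1 + 4 * ε) * (N * (N * (N : ℝ) ^ (-(c / 2))))) *
        Nat.factorial N := by ring
    _ ≤ _ := by gcongr

end Cost

/-- For every `c ≥ 10`, `ε ∈ (0,1/4)` and every signed graph on `n ≥ 2`
vertices, sequential Truncated-Pivot run with a uniformly random permutation has expected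
cost at most `(3+12ε)·OPT + (1+4ε)·n^(3-c/2)`; in particular, whenever `OPT ≥ 1` and `n`
is large enough, the expected cost is at most `(3+13ε)·OPT`. -/
theorem seq_truncated_pivot_approx (c ε : ℝ) (hc : 10 ≤ c) (hε0 : 0 < ε) (hε : ε < 1 / 4) :
    (∀ N : ℕ, 2 ≤ N → ∀ adj : Fin N → Fin N → Bool,
      (∀ u v, adj u v = adj v u) → (∀ u, adj u u = false) →
      Ex N (fun π => (cost adj (seqLabel adj c ε π) : ℝ)) ≤
        (3 + 12 * ε) * (OPT adj : ℝ) + (1 + 4 * ε) * (N : ℝ) ^ ((3 : ℝ) - c / 2)) ∧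
    (∃ n₀ : ℕ, ∀ N : ℕ, n₀ ≤ N → ∀ adj : Fin N → Fin N → Bool,
      (∀ u v, adj u v = adj v u) → (∀ u, adj u u = false) → 1 ≤ OPT adj →
      Ex N (fun π => (cost adj (seqLabel adj c ε π) : ℝ)) ≤ (3 + 13 * ε) * (OPT adj : ℝ)) := by
  have main : ∀ N : ℕ, 2 ≤ N → ∀ adj : Fin N → Fin N → Bool,
      (∀ u v, adj u v = adj v u) → (∀ u, adj u u = false) →
      Ex N (fun π => (cost adj (seqLabel adj c ε π) : ℝ)) ≤
        (3 + 12 * ε) * (OPT adj : ℝ) + (1 + 4 * ε) * (N : ℝ) ^ ((3 : ℝ) - c / 2) :=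
    fun N hN adj hs hi => Ex_cost_le (by linarith) hε0 hε hN hs hi
  refine ⟨main, max 2 ⌈2 / ε⌉₊, fun N hN adj hs hi hopt => ?_⟩
  have hN2 : 2 ≤ N := (le_max_left _ _).trans hN
  have hN' : 2 / ε ≤ N := (Nat.le_ceil _).trans (by exact_mod_cast (le_max_right _ _).trans hN)
  have hN1 : (1 : ℝ) ≤ N := by exact_mod_cast (by omega : 1 ≤ N)
  have hpow : (N : ℝ) ^ ((3 : ℝ) - c / 2) ≤ ε / 2 := by
    calc (N : ℝ) ^ ((3 : ℝ) - c / 2) ≤ (N : ℝ) ^ (-1 : ℝ) :=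
          Real.rpow_le_rpow_of_exponent_le hN1 (by linarith)
      _ = (N : ℝ)⁻¹ := Real.rpow_neg_one _
      _ ≤ (2 / ε)⁻¹ := inv_anti₀ (by positivity) hN'
      _ = ε / 2 := inv_div _ _
  have hopt' : (1 : ℝ) ≤ OPT adj := by exact_mod_cast hopt
  have hmain := main N hN2 adj hs hi
  have : (1 + 4 * ε) * (N : ℝ) ^ ((3 : ℝ) - c / 2) ≤ 2 * (ε / 2) := by
    gcongr
    linarith
  nlinarith

end TruncatedPivot
end

section
/- Fix any permutation π of the vertex set V. Running sequential Truncated-Pivot with π outputs exactly the same clustering (the same partition of V into pivot clusters and singleton clusters) as running parallel Truncated-Pivot with π. -/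
open scoped Classical

namespace TruncatedPivot

variable {N : ℕ}

/-- Membership in the greedy independent set built from a strictly increasing list of
positions. -/
theorem mem_foldl_greedy (R : Fin N → Prop) (adj : Fin N → Fin N → Bool)
    (π : Equiv.Perm (Fin N)) (l : List (Fin N)) (hl : l.Pairwise (· < ·)) (u : Fin N) :
    u ∈ l.foldl (fun (I : Finset (Fin N)) j =>
        if R (π.symm j) ∧ ∀ v ∈ I, adj (π.symm j) v = false then
          insert (π.symm j) I
        else I) ∅ ↔
      π u ∈ l ∧ R u ∧ ∀ v ∈ l.foldl (fun (I : Finset (Fin N)) j =>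
        if R (π.symm j) ∧ ∀ v ∈ I, adj (π.symm j) v = false then
          insert (π.symm j) I
        else I) ∅, π v < π u → adj u v = false := by
  induction l using List.reverseRecOn generalizing u with
  | nil => simp
  | append_singleton l j ih =>
    rw [List.pairwise_append] at hl
    obtain ⟨hl, -, hlt⟩ := hl
    replace ih := ih hl
    simp only [List.foldl_append, List.foldl_cons, List.foldl_nil, List.mem_append,
      List.mem_singleton]
    generalize List.foldl _ _ l = I at ih ⊢
    have hI : ∀ v ∈ I, π v < j := fun v hv => hlt _ ((ih v).1 hv).1 _ (by simp)
    have hl' : ∀ i ∈ l, i < j := fun i hi => hlt _ hi _ (by simp)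
    obtain rfl | hu := eq_or_ne u (π.symm j)
    · have hnot : π.symm j ∉ I := fun h => by simpa using hI _ h
      split_ifs with h
      · refine ⟨fun _ => ⟨by simp, h.1, fun v hv hlt => ?_⟩, fun _ => by simp⟩
        rcases Finset.mem_insert.1 hv with rfl | hv
        · exact absurd hlt (lt_irrefl _)
        · exact h.2 v hv
      · refine ⟨fun h' => absurd h' hnot, fun h' => absurd ⟨h'.2.1, fun v hv => ?_⟩ h⟩
        exact h'.2.2 v hv (by simpa using hI v hv)
    · have hu' : π u ≠ j := fun h => hu (by simp [← h])
      split_ifs with h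
      · rw [Finset.mem_insert, ih]
        simp only [hu, hu', false_or, or_false, Finset.forall_mem_insert,
          Equiv.apply_symm_apply]
        refine and_congr_right fun hul => and_congr_right fun _ => ?_
        exact ⟨fun h => ⟨fun h' => absurd h' (hl' _ hul).not_gt, h⟩, fun h => h.2⟩
      · rw [or_iff_left hu']
        exact ih u

theorem mem_pivots_iff (adj : Fin N → Fin N → Bool) (c ε : ℝ) (π : Equiv.Perm (Fin N))
    (u : Fin N) :
    u ∈ pivots adj c ε π ↔ interesting adj c ε π u ∧
      ∀ v ∈ pivots adj c ε π, π v < π u → adj u v = false := by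
  have h := mem_foldl_greedy (interesting adj c ε π) adj π (List.finRange N)
    (List.pairwise_lt_finRange N) u
  simp only [List.mem_finRange, true_and] at h
  unfold pivots
  exact h

/-- `v` is still below the singleton threshold at iteration `i`. -/
def belowThreshold (adj : Fin N → Fin N → Bool) (c ε : ℝ) (i : ℕ) (v : Fin N) : Prop :=
  (i : ℝ) * (deg adj v : ℝ) < (c / ε) * ((N : ℝ) * Real.log N)

theorem belowThreshold.anti {adj : Fin N → Fin N → Bool} {c ε : ℝ} {i j : ℕ} {v : Fin N}
    (h : belowThreshold adj c ε j v) (hij : i ≤ j) : belowThreshold adj c ε i v := by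
  refine lt_of_le_of_lt ?_ h
  gcongr

/-- `p` is a pivot whose cluster `v` may join when `p` is processed. -/
def eligible (adj : Fin N → Fin N → Bool) (c ε : ℝ) (π : Equiv.Perm (Fin N))
    (v p : Fin N) : Prop :=
  p ∈ pivots adj c ε π ∧ (v = p ∨ adj v p = true) ∧
    belowThreshold adj c ε ((π p).val + 1) v

theorem interesting_iff (adj : Fin N → Fin N → Bool) (c ε : ℝ) (π : Equiv.Perm (Fin N))
    (u : Fin N) :
    interesting adj c ε π u ↔ belowThreshold adj c ε ((π u).val + 1) u := by
  simp [interesting, belowThreshold]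

theorem singStep_eq_active_iff (adj : Fin N → Fin N → Bool) (c ε : ℝ) (i : ℕ)
    (s : Fin N → Status N) (v : Fin N) :
    singStep adj c ε i s v = Status.active ↔
      s v = Status.active ∧ belowThreshold adj c ε i v := by
  unfold singStep belowThreshold
  rw [mul_comm (i : ℝ), ← not_le]
  split_ifs <;> simp_all

theorem singStep_eq_clustered_iff (adj : Fin N → Fin N → Bool) (c ε : ℝ) (i : ℕ)
    (s : Fin N → Status N) (v p : Fin N) :
    singStep adj c ε i s v = Status.clustered p ↔ s v = Status.clustered p := by
  unfold singStep
  split_ifs <;> simp_all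

theorem pivStep_eq_active_iff (adj : Fin N → Fin N → Bool) (u : Fin N)
    (s : Fin N → Status N) (v : Fin N) :
    pivStep adj u s v = Status.active ↔
      s v = Status.active ∧ ¬ (s u = Status.active ∧ (v = u ∨ adj u v = true)) := by
  unfold pivStep
  split_ifs with h
  · exact ⟨fun h' => (by cases h'), fun h' => absurd ⟨h.1, h.2.2⟩ h'.2⟩
  · exact ⟨fun h' => ⟨h', fun h2 => h ⟨h2.1, h', h2.2⟩⟩, And.left⟩

theorem pivStep_eq_clustered_iff (adj : Fin N → Fin N → Bool) (u : Fin N)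
    (s : Fin N → Status N) (v p : Fin N) :
    pivStep adj u s v = Status.clustered p ↔
      s v = Status.clustered p ∨
        (p = u ∧ s v = Status.active ∧ s u = Status.active ∧ (v = u ∨ adj u v = true)) := by
  unfold pivStep
  split_ifs with h
  · rw [Status.clustered.injEq]
    constructor
    · rintro rfl
      exact Or.inr ⟨rfl, h.2.1, h.1, h.2.2⟩
    · rintro (h' | ⟨h', -⟩)
      · rw [h.2.1] at h'
        cases h'
      · exact h'.symm
  · constructor
    · exact Or.inl
    · rintro (h' | ⟨-, h1, h2, h3⟩)
      · exact h'
      · exact absurd ⟨h2, h1, h3⟩ h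

/-- A node is a pivot iff it is below its threshold at its own position and no earlier
pivot is eligible for it. -/
theorem mem_pivots_iff_not_eligible (adj : Fin N → Fin N → Bool) (c ε : ℝ)
    (π : Equiv.Perm (Fin N)) (u : Fin N) :
    u ∈ pivots adj c ε π ↔
      (∀ p, π p < π u → ¬ eligible adj c ε π u p) ∧
        belowThreshold adj c ε ((π u).val + 1) u := by
  rw [mem_pivots_iff, interesting_iff, and_comm]
  refine and_congr_left fun hu => ⟨fun h p hp hel => ?_, fun h p hp hlt => ?_⟩
  · rcases hel.2.1 with rfl | hadj
    · exact lt_irrefl _ hp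
    · simp [h p hel.1 hp] at hadj
  · by_contra hadj
    exact h p hlt ⟨hp, Or.inr (by simpa using hadj),
      hu.anti (Nat.succ_le_succ (le_of_lt hlt))⟩

/-- Description of the state of sequential Truncated-Pivot after `k` iterations. -/
theorem seqStates_spec (adj : Fin N → Fin N → Bool) (c ε : ℝ)
    (hsymm : ∀ u v, adj u v = adj v u) (π : Equiv.Perm (Fin N)) (k : ℕ) (hk : k ≤ N)
    (v : Fin N) :
    (seqStates adj c ε π k v = Status.active ↔
      (∀ p, (π p).val < k → ¬ eligible adj c ε π v p) ∧
        ∀ i < k, belowThreshold adj c ε (i + 1) v) ∧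
    ∀ p, seqStates adj c ε π k v = Status.clustered p ↔
      eligible adj c ε π v p ∧ (π p).val < k ∧
        ∀ q, π q < π p → ¬ eligible adj c ε π v q := by
  induction k generalizing v with
  | zero => simp [seqStates]
  | succ k ih =>
    have hkN : k < N := hk
    replace ih := ih hkN.le
    obtain ⟨u, hu⟩ : ∃ u, u = π.symm ⟨k, hkN⟩ := ⟨_, rfl⟩
    have hπu : π u = ⟨k, hkN⟩ := by simp [hu]
    have hval : (π u).val = k := by simp [hπu]
    have hlt : ∀ p, (π p).val < k + 1 ↔ (π p).val < k ∨ p = u := fun p => by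
      rw [Nat.lt_succ_iff_lt_or_eq, ← hval, ← Fin.ext_iff, π.injective.eq_iff]
    have hall : ∀ w, belowThreshold adj c ε (k + 1) w →
        ∀ i < k, belowThreshold adj c ε (i + 1) w :=
      fun w hw i hi => hw.anti (by omega)
    have hpiv : seqStates adj c ε π k u = Status.active ∧ belowThreshold adj c ε (k + 1) u ↔
        u ∈ pivots adj c ε π := by
      rw [mem_pivots_iff_not_eligible, (ih u).1, hval]
      simp only [Fin.lt_def, hval]
      exact ⟨fun h => ⟨h.1.1, h.2⟩, fun h => ⟨⟨h.1, hall u h.2⟩, h.2⟩⟩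
    have hel : eligible adj c ε π v u ↔ u ∈ pivots adj c ε π ∧
        (v = u ∨ adj u v = true) ∧ belowThreshold adj c ε (k + 1) v := by
      rw [eligible, hval, hsymm]
    have hstep : seqStates adj c ε π (k + 1) =
        pivStep adj u (singStep adj c ε (k + 1) (seqStates adj c ε π k)) := by
      simp only [seqStates, hkN, dif_pos, hu]
    rw [hstep]
    refine ⟨?_, fun p => ?_⟩
    · rw [pivStep_eq_active_iff, singStep_eq_active_iff, singStep_eq_active_iff, hpiv,
        (ih v).1]
      simp only [hlt, Nat.lt_succ_iff_lt_or_eq, or_imp, forall_and, forall_eq, hel]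
      tauto
    · rw [pivStep_eq_clustered_iff, singStep_eq_clustered_iff, singStep_eq_active_iff,
        singStep_eq_active_iff, hpiv, (ih v).1, (ih v).2, hlt]
      constructor
      · rintro (⟨h1, h2, h3⟩ | ⟨rfl, ⟨⟨h1, -⟩, h2⟩, h3, h4⟩)
        · exact ⟨h1, Or.inl h2, h3⟩
        · exact ⟨hel.2 ⟨h3, h4, h2⟩, Or.inr rfl, fun q hq => h1 q (hval ▸ hq)⟩
      · rintro ⟨h1, h2 | rfl, h3⟩
        · exact Or.inl ⟨h1, h2, h3⟩
        · obtain ⟨h4, h5, h6⟩ := hel.1 h1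
          exact Or.inr ⟨rfl, ⟨⟨fun q hq => h3 q (Fin.lt_def.2 (hval.symm ▸ hq)),
            hall v h6⟩, h6⟩, h4, h5⟩

/-- The sequential label is the first eligible pivot, if there is one. -/
theorem seqLabel_eq_of_first (adj : Fin N → Fin N → Bool) (c ε : ℝ)
    (hsymm : ∀ u v, adj u v = adj v u) (π : Equiv.Perm (Fin N)) {v p : Fin N}
    (hp : eligible adj c ε π v p) (hmin : ∀ q, π q < π p → ¬ eligible adj c ε π v q) :
    seqLabel adj c ε π v = p := by
  have h := ((seqStates_spec adj c ε hsymm π N le_rfl v).2 p).2 ⟨hp, (π p).isLt, hmin⟩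
  simp [seqLabel, h]

theorem seqLabel_eq_self (adj : Fin N → Fin N → Bool) (c ε : ℝ)
    (hsymm : ∀ u v, adj u v = adj v u) (π : Equiv.Perm (Fin N)) {v : Fin N}
    (hv : ∀ p, ¬ eligible adj c ε π v p) :
    seqLabel adj c ε π v = v := by
  have h := (seqStates_spec adj c ε hsymm π N le_rfl v).2
  unfold seqLabel
  split
  · next p hp => exact absurd ((h p).1 hp).1 (hv p)
  · rfl

theorem seqLabel_eq_parLabel (adj : Fin N → Fin N → Bool) (c ε : ℝ)
    (hsymm : ∀ u v, adj u v = adj v u) (π : Equiv.Perm (Fin N)) (v : Fin N) :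
    seqLabel adj c ε π v = parLabel adj c ε π v := by
  unfold parLabel
  split_ifs with hv
  · have h := (mem_pivots_iff_not_eligible adj c ε π v).1 hv
    exact seqLabel_eq_of_first adj c ε hsymm π ⟨hv, Or.inl rfl, h.2⟩ h.1
  · extract_lets S
    have hS : ∀ p, p ∈ S ↔ eligible adj c ε π v p := fun p => by
      simp only [S, Finset.mem_filter, eligible, belowThreshold, Nat.cast_add, Nat.cast_one]
      refine and_congr_right fun hp => and_congr_left fun _ => (or_iff_right ?_).symm
      rintro rfl
      exact hv hp
    split_ifs with hne
    · obtain ⟨p, hp, hpmin⟩ := Finset.mem_image.1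
        ((S.image fun v => π v).min'_mem (hne.image _))
      rw [← hpmin, Equiv.symm_apply_apply]
      refine seqLabel_eq_of_first adj c ε hsymm π ((hS p).1 hp) fun q hq hel => ?_
      refine absurd hq (not_lt.2 ?_)
      rw [hpmin]
      exact Finset.min'_le _ _ (Finset.mem_image_of_mem _ ((hS q).2 hel))
    · exact seqLabel_eq_self adj c ε hsymm π fun p hp => hne ⟨p, (hS p).2 hp⟩

/-- For every fixed permutation `π`, sequential Truncated-Pivot and
parallel Truncated-Pivot output exactly the same clustering, i.e. the partitions induced
by their cluster labels coincide. -/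
theorem seq_eq_par_clustering (N : ℕ) (c ε : ℝ) (hc : 0 < c) (hε0 : 0 < ε) (hε1 : ε < 1)
    (adj : Fin N → Fin N → Bool)
    (hsymm : ∀ u v, adj u v = adj v u) (hirr : ∀ u, adj u u = false)
    (π : Equiv.Perm (Fin N)) :
    ∀ u v : Fin N,
      (seqLabel adj c ε π u = seqLabel adj c ε π v ↔
        parLabel adj c ε π u = parLabel adj c ε π v) := by
  intro u v
  simp only [seqLabel_eq_parLabel adj c ε hsymm π]


end TruncatedPivot
end

section
/- Over a uniformly random permutation π, the expected number of disagreements induced by the pivot clusters of sequential Truncated-Pivot satisfies E[C^pivot] ≤ Σ_{t ∈ T} p_t, where the sum is over all bad triangles t and p_t = Pr[A_t]. -/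
open scoped Classical

namespace TruncatedPivot

variable {N : ℕ}

theorem seqStates_eq_active_of_succ (adj : Fin N → Fin N → Bool) (c ε : ℝ)
    (π : Equiv.Perm (Fin N)) {k : ℕ} {v : Fin N}
    (h : seqStates adj c ε π (k + 1) v = Status.active) :
    seqStates adj c ε π k v = Status.active := by
  simp only [seqStates] at h
  split_ifs at h with hk
  · simp only [pivStep, singStep] at h
    split_ifs at h <;> exact h
  · exact h

theorem seqStates_eq_active_of_le (adj : Fin N → Fin N → Bool) (c ε : ℝ)
    (π : Equiv.Perm (Fin N)) {k l : ℕ} (hkl : k ≤ l) {v : Fin N}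
    (h : seqStates adj c ε π l v = Status.active) :
    seqStates adj c ε π k v = Status.active := by
  induction l, hkl using Nat.le_induction with
  | base => exact h
  | succ l _ ih => exact ih (seqStates_eq_active_of_succ adj c ε π h)

theorem seqStates_eq_active_of_midState (adj : Fin N → Fin N → Bool) (c ε : ℝ)
    (π : Equiv.Perm (Fin N)) {k : ℕ} {v : Fin N}
    (h : midState adj c ε π k v = Status.active) :
    seqStates adj c ε π k v = Status.active := by
  simp only [midState, singStep] at h
  split_ifs at h
  exact h

/-- The node processed in an iteration is no longer active afterwards. -/
theorem seqStates_succ_symm_ne_active (adj : Fin N → Fin N → Bool) (c ε : ℝ)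
    (π : Equiv.Perm (Fin N)) (k : Fin N) :
    seqStates adj c ε π (k.val + 1) (π.symm k) ≠ Status.active := by
  intro h
  simp only [seqStates, k.isLt, dite_true, pivStep, Fin.eta, true_or, and_true, and_self] at h
  split_ifs at h with h'
  exact h' h

theorem le_of_midState_symm_eq_active (adj : Fin N → Fin N → Bool) (c ε : ℝ)
    (π : Equiv.Perm (Fin N)) {k l : Fin N}
    (h : midState adj c ε π l.val (π.symm k) = Status.active) : l ≤ k := by
  by_contra! hlt
  exact seqStates_succ_symm_ne_active adj c ε π k
    (seqStates_eq_active_of_le adj c ε π (Nat.succ_le_of_lt hlt)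
      (seqStates_eq_active_of_midState adj c ε π h))

/-- Every clustered node joined the cluster of its pivot in the iteration of that pivot. -/
theorem exists_iteration_of_seqStates_eq_clustered (adj : Fin N → Fin N → Bool) (c ε : ℝ)
    (π : Equiv.Perm (Fin N)) {n : ℕ} {v q : Fin N}
    (h : seqStates adj c ε π n v = Status.clustered q) :
    ∃ k : Fin N, π.symm k = q ∧ midState adj c ε π k.val q = Status.active ∧
      midState adj c ε π k.val v = Status.active ∧ inPivCluster adj q v := by
  induction n with
  | zero => simp [seqStates] at h
  | succ n ih =>
    simp only [seqStates] at h
    split_ifs at h with hn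
    · rw [pivStep] at h
      split_ifs at h with hc
      · obtain rfl : π.symm ⟨n, hn⟩ = q := by simpa using h
        exact ⟨⟨n, hn⟩, rfl, hc⟩
      · rw [singStep] at h
        split_ifs at h
        exact ih h
    · exact ih h

/-- The pair `p` together with the pivot of some iteration, which is not in `p`, makes up `t`,
and all of `t` is active when that pivot creates its cluster. -/
def Charges (adj : Fin N → Fin N → Bool) (c ε : ℝ) (π : Equiv.Perm (Fin N))
    (p : Fin N × Fin N) (t : Finset (Fin N)) : Prop :=
  ∃ k : Fin N, p.1 < p.2 ∧ π.symm k ≠ p.1 ∧ π.symm k ≠ p.2 ∧ t = {π.symm k, p.1, p.2} ∧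
    ∀ x ∈ t, midState adj c ε π k.val x = Status.active

theorem Charges.eventA {adj : Fin N → Fin N → Bool} {c ε : ℝ} {π : Equiv.Perm (Fin N)}
    {p : Fin N × Fin N} {t : Finset (Fin N)} (h : Charges adj c ε π p t) :
    eventA adj c ε t π := by
  obtain ⟨k, -, -, -, rfl, hact⟩ := h
  exact ⟨k, by simp, hact⟩

theorem Charges.left_unique {adj : Fin N → Fin N → Bool} {c ε : ℝ} {π : Equiv.Perm (Fin N)}
    {p q : Fin N × Fin N} {t : Finset (Fin N)} (hp : Charges adj c ε π p t)
    (hq : Charges adj c ε π q t) : p = q := by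
  obtain ⟨k, hlt, h1, h2, ht, hact⟩ := hp
  obtain ⟨l, hlt', h1', h2', ht', hact'⟩ := hq
  obtain rfl : k = l := le_antisymm
    (le_of_midState_symm_eq_active adj c ε π (hact _ (by simp [ht'])))
    (le_of_midState_symm_eq_active adj c ε π (hact' _ (by simp [ht])))
  obtain ⟨a, b⟩ := p
  obtain ⟨a', b'⟩ := q
  have hab : ({a, b} : Finset (Fin N)) = {a', b'} := by
    have := congrArg (fun s => Finset.erase s (π.symm k)) (ht.symm.trans ht')
    simpa [Finset.erase_insert, h1, h2, h1', h2'] using this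
  have ha : a = a' ∨ a = b' := by simpa using hab.le (by simp : a ∈ _)
  have hb : b = a' ∨ b = b' := by simpa using hab.le (by simp : b ∈ _)
  simp only at hlt hlt'
  rw [Prod.mk.injEq]
  omega

theorem exists_charges_of_cutAt {adj : Fin N → Fin N → Bool} {c ε : ℝ}
    {π : Equiv.Perm (Fin N)} (hsymm : ∀ u v, adj u v = adj v u) {a b k : Fin N}
    (hlt : a < b) (hab : adj a b = true) (hcut : cutAt adj c ε π k a b) :
    ∃ t ∈ badTriangles adj, Charges adj c ε π (a, b) t := by
  obtain ⟨hp, ha, hb, hin⟩ := hcut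
  simp only [inPivCluster, not_or, Bool.not_eq_true] at hin
  refine ⟨{π.symm k, a, b}, ?_, k, hlt, ?_, ?_, rfl, by simp [hp, ha, hb]⟩
  · rw [badTriangles, Finset.mem_filter_univ]
    rcases hin with ⟨h | h, hb1, hb2⟩ | ⟨h | h, ha1, ha2⟩
    · subst h; simp [hab] at hb2
    · exact ⟨π.symm k, a, b, rfl, by grind, hlt.ne, Ne.symm hb1, h, hab, hb2⟩
    · subst h; simp [hsymm _ a, hab] at ha2
    · exact ⟨π.symm k, b, a, by rw [Finset.pair_comm], by grind, hlt.ne', Ne.symm ha1, h,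
        by rw [hsymm, hab], ha2⟩
  all_goals grind

theorem exists_charges_of_clustered {adj : Fin N → Fin N → Bool} {c ε : ℝ}
    {π : Equiv.Perm (Fin N)} (hsymm : ∀ u v, adj u v = adj v u) {a b q : Fin N} {n : ℕ}
    (hlt : a < b) (hab : adj a b = false)
    (ha : seqStates adj c ε π n a = Status.clustered q)
    (hb : seqStates adj c ε π n b = Status.clustered q) :
    ∃ t ∈ badTriangles adj, Charges adj c ε π (a, b) t := by
  obtain ⟨k, rfl, hq, haact, hina⟩ := exists_iteration_of_seqStates_eq_clustered adj c ε π ha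
  obtain ⟨l, hl, -, hbact, hinb⟩ := exists_iteration_of_seqStates_eq_clustered adj c ε π hb
  obtain rfl : l = k := π.symm.injective hl
  have hne := hlt.ne
  have hba := hsymm a b
  rw [inPivCluster] at hina hinb
  have hqa : π.symm l ≠ a := by grind
  have hqb : π.symm l ≠ b := by grind
  have hadja : adj (π.symm l) a = true := hina.resolve_left hqa.symm
  have hadjb : adj (π.symm l) b = true := hinb.resolve_left hqb.symm
  refine ⟨{π.symm l, a, b}, ?_, l, hlt, hqa, hqb, rfl, by simp [hq, haact, hbact]⟩
  rw [badTriangles, Finset.mem_filter_univ]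
  exact ⟨a, π.symm l, b, by rw [Finset.insert_comm], hqa.symm, hqb, hne,
    by rw [hsymm, hadja], hadjb, hab⟩

/-- In every run, each disagreement induced by a pivot cluster can be charged to its own bad
triangle whose event occurs. -/
theorem Cpivot_le_card_badTriangles_eventA (adj : Fin N → Fin N → Bool) (c ε : ℝ)
    (π : Equiv.Perm (Fin N)) (hsymm : ∀ u v, adj u v = adj v u) :
    Cpivot adj c ε π ≤ ((badTriangles adj).filter fun t => eventA adj c ε t π).card := by
  refine Finset.card_le_card_of_forall_subsingleton (Charges adj c ε π) ?_ ?_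
  · rintro ⟨a, b⟩ h
    rw [Finset.mem_filter_univ] at h
    obtain ⟨t, ht, hch⟩ : ∃ t ∈ badTriangles adj, Charges adj c ε π (a, b) t := by
      obtain ⟨hlt, ⟨hab, k, hcut⟩ | ⟨hab, q, ha, hb⟩⟩ := h
      · exact exists_charges_of_cutAt hsymm hlt hab hcut
      · exact exists_charges_of_clustered hsymm hlt hab ha hb
    exact ⟨t, Finset.mem_filter.2 ⟨ht, hch.eventA⟩, hch⟩
  · rintro t - p ⟨-, hp⟩ q ⟨-, hq⟩
    exact hp.left_unique hq

/-- Over a uniformly random permutation, the expected number of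
disagreements induced by the pivot clusters of sequential Truncated-Pivot is at most
`Σ_{t ∈ T} p_t`, summed over all bad triangles `t`, with `p_t = Pr[A_t]`. -/
theorem expected_Cpivot_le_sum_pt (N : ℕ) (c ε : ℝ) (hc : 0 < c) (hε0 : 0 < ε) (hε1 : ε < 1)
    (adj : Fin N → Fin N → Bool)
    (hsymm : ∀ u v, adj u v = adj v u) (hirr : ∀ u, adj u u = false) :
    Ex N (fun π => (Cpivot adj c ε π : ℝ)) ≤
      ∑ t ∈ badTriangles adj, Pr N (eventA adj c ε t) := by
  have hswap : ∑ t ∈ badTriangles adj, (Finset.univ.filter (eventA adj c ε t)).card =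
      ∑ π, ((badTriangles adj).filter fun t => eventA adj c ε t π).card :=
    Finset.sum_card_bipartiteAbove_eq_sum_card_bipartiteBelow _
  simp only [Ex, Pr]
  rw [← Finset.sum_div]
  gcongr
  exact_mod_cast (Finset.sum_le_sum fun π _ =>
    Cpivot_le_card_badTriangles_eventA adj c ε π hsymm).trans_eq hswap.symm


end TruncatedPivot
end

section
/- Let y assign a nonnegative real y_t to every bad triangle t such that for every unordered pair e of distinct vertices Σ_{t ∈ T, e ⊆ t} y_t ≤ 1. Then Σ_{t ∈ T} y_t ≤ OPT, i.e. the value of any feasible fractional bad-triangle packing is a lower bound on the minimum number of disagreements of any clustering. -/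
open scoped Classical

namespace TruncatedPivot

variable {N : ℕ}

/-- The disagreements of the clustering whose parts are the fibers of `f`. -/
noncomputable def disagreements (adj : Fin N → Fin N → Bool) (f : Fin N → Fin N) :
    Finset (Fin N × Fin N) :=
  Finset.univ.filter fun p : Fin N × Fin N =>
    p.1 < p.2 ∧ ((adj p.1 p.2 = true ∧ f p.1 ≠ f p.2) ∨
      (adj p.1 p.2 = false ∧ f p.1 = f p.2))

theorem card_disagreements (adj : Fin N → Fin N → Bool) (f : Fin N → Fin N) :
    (disagreements adj f).card = cost adj f := by
  unfold disagreements cost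
  congr!

theorem exists_mem_disagreements {adj : Fin N → Fin N → Bool}
    (hsymm : ∀ u v, adj u v = adj v u) {f : Fin N → Fin N} {a b : Fin N} (hab : a ≠ b)
    (h : (adj a b = true ∧ f a ≠ f b) ∨ (adj a b = false ∧ f a = f b))
    {t : Finset (Fin N)} (ha : a ∈ t) (hb : b ∈ t) :
    ∃ p ∈ disagreements adj f, p.1 ∈ t ∧ p.2 ∈ t := by
  rcases lt_or_gt_of_ne hab with hlt | hlt
  · exact ⟨(a, b), by simpa [disagreements, hlt] using h, ha, hb⟩
  · refine ⟨(b, a), ?_, hb, ha⟩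
    rw [hsymm a b, ne_comm, eq_comm (a := f a)] at h
    simpa [disagreements, hlt] using h

/-- Every clustering has a disagreement inside every bad triangle. -/
theorem IsBadTriangle.exists_mem_disagreements {adj : Fin N → Fin N → Bool}
    (hsymm : ∀ u v, adj u v = adj v u) (f : Fin N → Fin N) {t : Finset (Fin N)}
    (ht : IsBadTriangle adj t) :
    ∃ p ∈ disagreements adj f, p.1 ∈ t ∧ p.2 ∈ t := by
  obtain ⟨u, v, w, rfl, huv, hvw, huw, auv, avw, auw⟩ := ht
  by_cases h₁ : f u = f v
  · by_cases h₂ : f v = f w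
    · exact TruncatedPivot.exists_mem_disagreements hsymm huw
        (Or.inr ⟨auw, h₁.trans h₂⟩) (by simp) (by simp)
    · exact TruncatedPivot.exists_mem_disagreements hsymm hvw
        (Or.inl ⟨avw, h₂⟩) (by simp) (by simp)
  · exact TruncatedPivot.exists_mem_disagreements hsymm huv
      (Or.inl ⟨auv, h₁⟩) (by simp) (by simp)

/-- Weak duality between bad-triangle packings and the disagreements of a clustering. -/
theorem packing_le_cost {adj : Fin N → Fin N → Bool}
    (hsymm : ∀ u v, adj u v = adj v u) (y : Finset (Fin N) → ℝ)
    (hpos : ∀ t ∈ badTriangles adj, 0 ≤ y t)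
    (hfeas : ∀ a b : Fin N, a ≠ b →
      ∑ t ∈ (badTriangles adj).filter (fun t => a ∈ t ∧ b ∈ t), y t ≤ 1)
    (f : Fin N → Fin N) :
    ∑ t ∈ badTriangles adj, y t ≤ (cost adj f : ℝ) := by
  calc ∑ t ∈ badTriangles adj, y t
      ≤ ∑ t ∈ badTriangles adj, ∑ p ∈ disagreements adj f,
          if p.1 ∈ t ∧ p.2 ∈ t then y t else 0 := by
        refine Finset.sum_le_sum fun t ht => ?_
        obtain ⟨p, hp, hpt⟩ :=
          IsBadTriangle.exists_mem_disagreements hsymm f (Finset.mem_filter.mp ht).2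
        calc y t = if p.1 ∈ t ∧ p.2 ∈ t then y t else 0 := (if_pos hpt).symm
          _ ≤ _ := Finset.single_le_sum
            (f := fun p : Fin N × Fin N => if p.1 ∈ t ∧ p.2 ∈ t then y t else 0)
            (fun q _ => by
              split_ifs
              exacts [hpos t ht, le_rfl]) hp
    _ = ∑ p ∈ disagreements adj f,
          ∑ t ∈ (badTriangles adj).filter (fun t => p.1 ∈ t ∧ p.2 ∈ t), y t := by
        rw [Finset.sum_comm]
        simp only [Finset.sum_filter]
    _ ≤ ∑ _p ∈ disagreements adj f, (1 : ℝ) := by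
        refine Finset.sum_le_sum fun p hp => ?_
        have h : p.1 ≠ p.2 := (Finset.mem_filter.mp hp).2.1.ne
        convert hfeas p.1 p.2 h
    _ = (cost adj f : ℝ) := by simp [card_disagreements]

/-- The value of any feasible fractional bad-triangle packing is a lower
bound on the minimum number of disagreements of any clustering: if `y_t ≥ 0` for every
bad triangle `t` and `Σ_{t ∋ e} y_t ≤ 1` for every unordered pair `e` of distinct
vertices, then `Σ_{t ∈ T} y_t ≤ OPT`. -/
theorem packing_le_OPT (N : ℕ) (adj : Fin N → Fin N → Bool)
    (hsymm : ∀ u v, adj u v = adj v u) (hirr : ∀ u, adj u u = false)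
    (y : Finset (Fin N) → ℝ)
    (hpos : ∀ t ∈ badTriangles adj, 0 ≤ y t)
    (hfeas : ∀ a b : Fin N, a ≠ b →
      ∑ t ∈ (badTriangles adj).filter (fun t => a ∈ t ∧ b ∈ t), y t ≤ 1) :
    ∑ t ∈ badTriangles adj, y t ≤ (OPT adj : ℝ) := by
  obtain ⟨f, hf⟩ : OPT adj ∈ Set.range (cost adj) := Nat.sInf_mem ⟨_, id, rfl⟩
  rw [← hf]
  exact packing_le_cost hsymm y hpos hfeas f


end TruncatedPivot
end
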